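/- With probability at least 1 − δ, the regret of the UCBVI-CH algorithm after K episodes satisfies Regret(K) ≤ 20·H^{3/2}·L·√(S·A·K) + 250·H²·S²·A·L², where L = ln(5·H·S·A·T/δ) and T = K·H. -/

import Mathlib

open scoped Classical

section UCBVI

variable {S A : Type*} [Fintype S] [Fintype A] [DecidableEq S] [DecidableEq A]
  [Nonempty S] [Nonempty A]

/-- Maximum of a real-valued function over the finite nonempty action space. -/
noncomputable def maxA (f : A → ℝ) : ℝ :=
  Finset.univ.sup' Finset.univ_nonempty f

/-- A fixed maximizer of a real-valued function over the finite nonempty action space. -/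
noncomputable def argmaxA (f : A → ℝ) : A :=
  (Finset.exists_max_image Finset.univ f
    ⟨Classical.arbitrary A, Finset.mem_univ _⟩).choose

/-- Optimistic Q-values computed by backward value iteration within one episode, indexed by
the number of remaining steps: index `j + 1` corresponds to step `h = H − j` (so index `H`
is step `1`), `Qiter … 0 = 0` plays the role of step `H + 1`, and
`V_{k,h+1}(y) = maxA (Qiter … j y ·)`.  `Qprev` are the Q-values of the previous episode
(same indexing), `Nk` the visit counts, `Phat` the empirical transition probabilities, and
`bonus j V x a` the exploration bonus at step `h = H − j` given the next-step value
estimates `V = V_{k,h+1}`.  For visited pairs,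
`Q_{k,h}(x,a) = min (Q_{k−1,h}(x,a)) (min H (R x a + ∑_y P̂(y|x,a)·V_{k,h+1}(y) + b))`;
unvisited pairs get value `H`. -/
noncomputable def Qiter (R : S → A → ℝ) (Phat : S → A → S → ℝ) (Nk : S → A → ℕ)
    (Qprev : ℕ → S → A → ℝ) (H : ℕ) (bonus : ℕ → (S → ℝ) → S → A → ℝ) :
    ℕ → S → A → ℝ
  | 0 => fun _ _ => 0
  | j + 1 => fun x a =>
      if Nk x a = 0 then (H : ℝ)
      else
        min (Qprev (j + 1) x a) (min (H : ℝ)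
          (R x a
            + (∑ y, Phat x a y * maxA (fun b => Qiter R Phat Nk Qprev H bonus j y b))
            + bonus j (fun y => maxA (fun b => Qiter R Phat Nk Qprev H bonus j y b)) x a))

/-- The learner's state before episode `k` (episodes are 0-indexed): visit counts
`N_k(x,a)`, transition counts `N_k(x,a,y)`, per-position state visit counts
(`Npos p y` = number of visits to `y` at trajectory position `p`, i.e. step `p + 1`, in
episodes `< k`), and the Q-values of the previous episode (initialized to the constant
`H`).  The trajectories are `ω : Fin K → Fin (H+1) → S` (`ω k p` = state at position `p`,
i.e. step `p + 1`, of episode `k`); in episode `k` the action at position `p < H` is the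
greedy action w.r.t. the Q-values computed from the data of episodes `< k`, and the counts
are updated accordingly.  The generic argument `bonus N Phat Npos j V x a` builds the
exploration bonus from the current statistics. -/
noncomputable def epState (R : S → A → ℝ) (H K : ℕ)
    (bonus : (S → A → ℕ) → (S → A → S → ℝ) → (ℕ → S → ℕ) → ℕ → (S → ℝ) → S → A → ℝ)
    (ω : Fin K → Fin (H + 1) → S) :
    ℕ → (S → A → ℕ) × (S → A → S → ℕ) × (ℕ → S → ℕ) × (ℕ → S → A → ℝ)
  | 0 => (fun _ _ => 0, fun _ _ _ => 0, fun _ _ => 0, fun _ _ _ => (H : ℝ))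
  | k + 1 =>
      let st := epState R H K bonus ω k
      if hk : k < K then
        let N := st.1
        let Nt := st.2.1
        let Npos := st.2.2.1
        let Qp := st.2.2.2
        let Phat := fun x a y => (Nt x a y : ℝ) / (N x a : ℝ)
        let Q := Qiter R Phat N Qp H (bonus N Phat Npos)
        let act : Fin H → A := fun p =>
          argmaxA (fun a => Q (H - p.val) (ω ⟨k, hk⟩ p.castSucc) a)
        ( fun x a => N x a + (Finset.univ.filter
            (fun p : Fin H => ω ⟨k, hk⟩ p.castSucc = x ∧ act p = a)).card,
          fun x a y => Nt x a y + (Finset.univ.filter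
            (fun p : Fin H =>
              ω ⟨k, hk⟩ p.castSucc = x ∧ act p = a ∧ ω ⟨k, hk⟩ p.succ = y)).card,
          fun q y => Npos q y
            + if hq : q < H + 1 then (if ω ⟨k, hk⟩ ⟨q, hq⟩ = y then 1 else 0) else 0,
          Q )
      else st

/-- The Q-values `Q_{k,·}` used during (0-indexed) episode `k`, indexed by remaining steps
`j = H + 1 − h`. -/
noncomputable def Qep (R : S → A → ℝ) (H K : ℕ)
    (bonus : (S → A → ℕ) → (S → A → S → ℝ) → (ℕ → S → ℕ) → ℕ → (S → ℝ) → S → A → ℝ)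
    (ω : Fin K → Fin (H + 1) → S) (k : ℕ) : ℕ → S → A → ℝ :=
  (epState R H K bonus ω (k + 1)).2.2.2

/-- The greedy policy `π_k` followed in episode `k`, as a function of the number of
remaining steps `j = H + 1 − h`: `π_k` at step `h` plays `argmax_a Q_{k,h}(x,a)`. -/
noncomputable def polep (R : S → A → ℝ) (H K : ℕ)
    (bonus : (S → A → ℕ) → (S → A → S → ℝ) → (ℕ → S → ℕ) → ℕ → (S → ℝ) → S → A → ℝ)
    (ω : Fin K → Fin (H + 1) → S) (k : ℕ) : ℕ → S → A :=
  fun j x => argmaxA (fun a => Qep R H K bonus ω k j x a)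

/-- Value function `V^π` of a policy `π` given as a function of remaining steps:
`VpolJ P R π j x` is the expected sum of the next `j` rewards, so
`V^π_1 = VpolJ P R π H` for horizon `H`. -/
noncomputable def VpolJ (P : S → A → S → ℝ) (R : S → A → ℝ) (π : ℕ → S → A) :
    ℕ → S → ℝ
  | 0 => fun _ => 0
  | j + 1 => fun x =>
      R x (π (j + 1) x) + ∑ y, P x (π (j + 1) x) y * VpolJ P R π j y

/-- Optimal value function indexed by remaining steps: `V*_1 = VstarJ P R H`. -/
noncomputable def VstarJ (P : S → A → S → ℝ) (R : S → A → ℝ) : ℕ → S → ℝ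
  | 0 => fun _ => 0
  | j + 1 => fun x =>
      maxA (fun a => R x a + ∑ y, P x a y * VstarJ P R j y)

/-- Regret of the UCBVI learner over `K` episodes with initial states `xinit`:
`Regret(K) = ∑_k [V*_1(x_{k,1}) − V^{π_k}_1(x_{k,1})]`. -/
noncomputable def ucbviRegret (P : S → A → S → ℝ) (R : S → A → ℝ) (H K : ℕ)
    (bonus : (S → A → ℕ) → (S → A → S → ℝ) → (ℕ → S → ℕ) → ℕ → (S → ℝ) → S → A → ℝ)
    (xinit : Fin K → S) (ω : Fin K → Fin (H + 1) → S) : ℝ :=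
  ∑ k : Fin K,
    (VstarJ P R H (xinit k) - VpolJ P R (polep R H K bonus ω k.val) H (xinit k))

/-- Probability of the full interaction history `ω`: each episode `k` starts at the
prescribed state `xinit k` and evolves by `P` under the greedy actions of episode `k`. -/
noncomputable def trajProb (P : S → A → S → ℝ) (R : S → A → ℝ) (H K : ℕ)
    (bonus : (S → A → ℕ) → (S → A → S → ℝ) → (ℕ → S → ℕ) → ℕ → (S → ℝ) → S → A → ℝ)
    (xinit : Fin K → S) (ω : Fin K → Fin (H + 1) → S) : ℝ :=
  ∏ k : Fin K,
    ((if ω k 0 = xinit k then (1 : ℝ) else 0) *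
      ∏ p : Fin H,
        P (ω k p.castSucc)
          (polep R H K bonus ω k.val (H - p.val) (ω k p.castSucc))
          (ω k p.succ))

/-- The Chernoff–Hoeffding exploration bonus of UCBVI-CH:
`b_{k,h}(x,a) = 7·H·L'·√(1 / N_k(x,a))` with `L' = ln(5·S·A·T/δ)`. -/
noncomputable def bonusCH (H : ℕ) (L' : ℝ) :
    (S → A → ℕ) → (S → A → S → ℝ) → (ℕ → S → ℕ) → ℕ → (S → ℝ) → S → A → ℝ :=
  fun N _ _ _ _ x a => 7 * H * L' * Real.sqrt (1 / (N x a : ℝ))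

set_option linter.unusedSectionVars false

/-- The path weights of a time-inhomogeneous Markov chain started at `x₀` sum to one. -/
theorem sum_markovPath (H : ℕ) (q : Fin H → S → S → ℝ) (hq : ∀ p x, ∑ y, q p x y = 1)
    (x₀ : S) :
    ∑ τ : Fin (H + 1) → S, (if τ 0 = x₀ then (1 : ℝ) else 0) *
      ∏ p : Fin H, q p (τ p.castSucc) (τ p.succ) = 1 := by
  induction H generalizing x₀ with
  | zero =>
    rw [← (Equiv.funUnique (Fin 1) S).symm.sum_comp]
    simp
  | succ H ih =>
    rw [← (Fin.consEquiv (fun _ : Fin (H + 2) => S)).sum_comp, Fintype.sum_prod_type]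
    have hterm : ∀ (s : S) (τ : Fin (H + 1) → S),
        ((if (Fin.cons s τ : Fin (H + 2) → S) 0 = x₀ then (1 : ℝ) else 0) *
          ∏ p : Fin (H + 1), q p ((Fin.cons s τ : Fin (H + 2) → S) p.castSucc)
            ((Fin.cons s τ : Fin (H + 2) → S) p.succ))
        = if s = x₀ then ∑ z, q 0 x₀ z * ((if τ 0 = z then (1 : ℝ) else 0) *
            ∏ p : Fin H, q p.succ (τ p.castSucc) (τ p.succ)) else 0 := by
      intro s τ
      by_cases hs : s = x₀
      · subst hs
        simp [Fin.prod_univ_succ]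
      · simp [hs]
    refine (Finset.sum_congr rfl fun s _ => Finset.sum_congr rfl fun τ _ => hterm s τ).trans ?_
    rw [Finset.sum_comm]
    simp only [Finset.sum_ite_eq', Finset.mem_univ, if_true]
    rw [Finset.sum_comm]
    simp_rw [← Finset.mul_sum]
    refine Eq.trans ?_ (hq 0 x₀)
    refine Finset.sum_congr rfl fun z _ => ?_
    rw [ih (fun p => q p.succ) (fun p x => hq _ _) z, mul_one]

/-- Products of adapted conditional weights sum to one. -/
theorem sum_adapted_prod {X : Type*} [Fintype X] [Nonempty X] (K : ℕ)
    (F : Fin K → (Fin K → X) → ℝ)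
    (hdep : ∀ k ω ω', (∀ i ≤ k, ω i = ω' i) → F k ω = F k ω')
    (hsum : ∀ k ω, ∑ x, F k (Function.update ω k x) = 1) :
    ∑ ω, ∏ k, F k ω = 1 := by
  induction K with
  | zero => simp
  | succ K ih =>
    rw [← (Fin.snocEquiv (fun _ : Fin (K + 1) => X)).sum_comp, Fintype.sum_prod_type_right]
    let x₀ : X := Classical.arbitrary X
    have hlast : ∀ τ : Fin K → X, ∑ x, F (Fin.last K) (Fin.snoc (α := fun _ => X) τ x) = 1 := by
      intro τ
      rw [← hsum (Fin.last K) (Fin.snoc (α := fun _ => X) τ x₀)]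
      simp [Fin.update_snoc_last]
    have hinit : ∀ (k : Fin K) (τ : Fin K → X) (x : X),
        F k.castSucc (Fin.snoc (α := fun _ => X) τ x)
          = F k.castSucc (Fin.snoc (α := fun _ => X) τ x₀) := by
      intro k τ x
      apply hdep
      intro i hi
      induction i using Fin.lastCases with
      | last => exact absurd (hi.trans_lt k.castSucc_lt_last) (lt_irrefl _)
      | cast i => simp
    simp only [Fin.snocEquiv, Equiv.coe_fn_mk, Fin.prod_univ_castSucc]
    simp_rw [hinit, ← Finset.mul_sum, hlast, mul_one]
    apply ih (fun k τ => F k.castSucc (Fin.snoc (α := fun _ => X) τ x₀))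
    · intro k τ τ' h
      apply hdep
      intro i hi
      induction i using Fin.lastCases with
      | last => simp
      | cast i => simpa using h i (by simpa using hi)
    · intro k τ
      rw [← hsum k.castSucc (Fin.snoc (α := fun _ => X) τ x₀)]
      refine Finset.sum_congr rfl fun x _ => ?_
      rw [Fin.snoc_update]

section Learner

variable (R : S → A → ℝ) (H K : ℕ)
    (bonus : (S → A → ℕ) → (S → A → S → ℝ) → (ℕ → S → ℕ) → ℕ → (S → ℝ) → S → A → ℝ)

/-- Visit counts `N_k(x,a)` before episode `k`. -/
noncomputable def visits (ω : Fin K → Fin (H + 1) → S) (k : ℕ) (x : S) (a : A) : ℕ :=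
  (epState R H K bonus ω k).1 x a

/-- Transition counts `N_k(x,a,y)` before episode `k`. -/
noncomputable def transitions (ω : Fin K → Fin (H + 1) → S) (k : ℕ) (x : S) (a : A) (y : S) : ℕ :=
  (epState R H K bonus ω k).2.1 x a y

/-- The action played at position `p` of episode `k`. -/
noncomputable def actionAt (ω : Fin K → Fin (H + 1) → S) (k : Fin K) (p : Fin H) : A :=
  polep R H K bonus ω k (H - p) (ω k p.castSucc)

/-- The learner's state before episode `k` is determined by the episodes before `k`. -/
theorem epState_congr {ω ω' : Fin K → Fin (H + 1) → S} (k : ℕ)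
    (h : ∀ i : Fin K, i.val < k → ω i = ω' i) :
    epState R H K bonus ω k = epState R H K bonus ω' k := by
  induction k with
  | zero => rfl
  | succ k ih =>
    have ih' := ih fun i hi => h i (hi.trans (Nat.lt_succ_self k))
    by_cases hk : k < K
    · simp only [epState, dif_pos hk, ih', h ⟨k, hk⟩ (Nat.lt_succ_self k)]
    · simp only [epState, ih', dif_neg hk]

/-- The Q-values of episode `k` in terms of the statistics gathered before it. -/
theorem Qep_eq (ω : Fin K → Fin (H + 1) → S) (k : Fin K) :
    Qep R H K bonus ω k =
      Qiter R (fun x a y => (transitions R H K bonus ω k x a y : ℝ) / visits R H K bonus ω k x a)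
        (visits R H K bonus ω k) (epState R H K bonus ω k).2.2.2 H
        (bonus (visits R H K bonus ω k)
          (fun x a y => (transitions R H K bonus ω k x a y : ℝ) / visits R H K bonus ω k x a)
          (epState R H K bonus ω k).2.2.1) := by
  unfold Qep
  rw [epState]
  simp only [dif_pos k.isLt]
  rfl

theorem Qep_congr {ω ω' : Fin K → Fin (H + 1) → S} (k : Fin K)
    (h : ∀ i : Fin K, i < k → ω i = ω' i) :
    Qep R H K bonus ω k = Qep R H K bonus ω' k := by
  have := epState_congr R H K bonus k.val h
  have hv : visits R H K bonus ω k = visits R H K bonus ω' k := by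
    unfold visits
    rw [this]
  have ht : transitions R H K bonus ω k = transitions R H K bonus ω' k := by
    unfold transitions
    rw [this]
  rw [Qep_eq, Qep_eq, hv, ht, this]

theorem polep_congr {ω ω' : Fin K → Fin (H + 1) → S} (k : Fin K)
    (h : ∀ i : Fin K, i < k → ω i = ω' i) :
    polep R H K bonus ω k = polep R H K bonus ω' k := by
  unfold polep
  rw [Qep_congr R H K bonus k h]

theorem visits_succ (ω : Fin K → Fin (H + 1) → S) (k : Fin K) (x : S) (a : A) :
    visits R H K bonus ω (k + 1) x a = visits R H K bonus ω k x a +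
      ∑ p : Fin H, if ω k p.castSucc = x ∧ actionAt R H K bonus ω k p = a then 1 else 0 := by
  rw [← Finset.card_filter]
  unfold visits actionAt polep
  rw [Qep_eq, epState]
  simp only [dif_pos k.isLt]
  rfl

theorem transitions_succ (ω : Fin K → Fin (H + 1) → S) (k : Fin K) (x : S) (a : A) (y : S) :
    transitions R H K bonus ω (k + 1) x a y = transitions R H K bonus ω k x a y +
      ∑ p : Fin H, if ω k p.castSucc = x ∧ actionAt R H K bonus ω k p = a ∧ ω k p.succ = y
        then 1 else 0 := by
  rw [← Finset.card_filter]
  unfold transitions actionAt polep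
  rw [Qep_eq, epState]
  simp only [dif_pos k.isLt]
  rfl

/-- Weighted transition counts as a sum over the observed transitions. -/
theorem sum_transitions_mul (ω : Fin K → Fin (H + 1) → S) (k : ℕ) (hk : k ≤ K) (x : S) (a : A)
    (g : S → ℝ) :
    ∑ y, (transitions R H K bonus ω k x a y : ℝ) * g y =
      ∑ i : Fin K, ∑ p : Fin H,
        if i.val < k ∧ ω i p.castSucc = x ∧ actionAt R H K bonus ω i p = a
          then g (ω i p.succ) else 0 := by
  induction k with
  | zero => simp [transitions, epState]
  | succ k ih =>
    have hkK : k < K := hk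
    have hsplit : ∀ (i : Fin K) (p : Fin H),
        (if i.val < k + 1 ∧ ω i p.castSucc = x ∧ actionAt R H K bonus ω i p = a
          then g (ω i p.succ) else 0) =
        (if i.val < k ∧ ω i p.castSucc = x ∧ actionAt R H K bonus ω i p = a
          then g (ω i p.succ) else 0) +
        if i = ⟨k, hkK⟩ then
          (if ω i p.castSucc = x ∧ actionAt R H K bonus ω i p = a
            then g (ω i p.succ) else 0) else 0 := by
      intro i p
      have hi : i = ⟨k, hkK⟩ ↔ i.val = k := Fin.ext_iff
      rcases lt_trichotomy i.val k with h | h | h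
      · simp [hi, h, h.ne, h.trans (Nat.lt_succ_self k)]
      · simp [hi, h]
      · simp [hi, h.ne', h.not_gt, not_lt.mpr (Nat.succ_le_of_lt h)]
    simp_rw [hsplit, Finset.sum_add_distrib]
    rw [← ih hkK.le]
    have hlast : (∑ i : Fin K, ∑ p : Fin H, if i = ⟨k, hkK⟩ then
          (if ω i p.castSucc = x ∧ actionAt R H K bonus ω i p = a
            then g (ω i p.succ) else 0) else 0) =
        ∑ p : Fin H, if ω ⟨k, hkK⟩ p.castSucc = x ∧ actionAt R H K bonus ω ⟨k, hkK⟩ p = a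
            then g (ω ⟨k, hkK⟩ p.succ) else 0 := by
      rw [Finset.sum_comm]
      simp
    rw [hlast]
    have hstep := fun y => transitions_succ R H K bonus ω ⟨k, hkK⟩ x a y
    simp only at hstep
    simp_rw [hstep]
    push_cast
    simp_rw [add_mul, Finset.sum_add_distrib, Finset.sum_mul]
    congr 1
    rw [Finset.sum_comm]
    refine Finset.sum_congr rfl fun p _ => ?_
    by_cases hp : ω ⟨k, hkK⟩ p.castSucc = x ∧ actionAt R H K bonus ω ⟨k, hkK⟩ p = a
    · simp [hp]
    · rw [if_neg hp]
      refine Finset.sum_eq_zero fun y _ => ?_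
      rw [if_neg (fun h => hp ⟨h.1, h.2.1⟩), zero_mul]

theorem sum_transitions (ω : Fin K → Fin (H + 1) → S) (k : ℕ) (hk : k ≤ K) (x : S) (a : A) :
    ∑ y, (transitions R H K bonus ω k x a y : ℝ) = visits R H K bonus ω k x a := by
  induction k with
  | zero => simp [transitions, visits, epState]
  | succ k ih =>
    have hT := fun y => transitions_succ R H K bonus ω ⟨k, hk⟩ x a y
    have hV := visits_succ R H K bonus ω ⟨k, hk⟩ x a
    simp only at hT hV
    simp_rw [hT, hV]
    push_cast
    rw [Finset.sum_add_distrib, ih (Nat.le_of_succ_le hk), Finset.sum_comm]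
    congr 1
    refine Finset.sum_congr rfl fun p _ => ?_
    by_cases hp : ω ⟨k, hk⟩ p.castSucc = x ∧ actionAt R H K bonus ω ⟨k, hk⟩ p = a
    · simp [hp]
    · rw [if_neg hp]
      exact Finset.sum_eq_zero fun y _ => if_neg fun h => hp ⟨h.1, h.2.1⟩

theorem visits_zero (ω : Fin K → Fin (H + 1) → S) (x : S) (a : A) :
    visits R H K bonus ω 0 x a = 0 := rfl

theorem visits_succ_le (ω : Fin K → Fin (H + 1) → S) (k : Fin K) (x : S) (a : A) :
    visits R H K bonus ω (k + 1) x a ≤ visits R H K bonus ω k x a + H := by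
  rw [visits_succ, ← Finset.card_filter]
  gcongr
  exact (Finset.card_le_univ _).trans_eq (Fintype.card_fin H)

theorem sum_visits (ω : Fin K → Fin (H + 1) → S) (k : ℕ) (hk : k ≤ K) :
    ∑ x, ∑ a, visits R H K bonus ω k x a = k * H := by
  induction k with
  | zero => simp [visits_zero]
  | succ k ih =>
    have hV := fun x a => visits_succ R H K bonus ω ⟨k, hk⟩ x a
    simp only at hV
    simp_rw [hV, Finset.sum_add_distrib]
    rw [ih (Nat.le_of_succ_le hk), add_mul, one_mul]
    congr 1
    simp_rw [Finset.sum_comm (s := (Finset.univ : Finset A))]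
    rw [Finset.sum_comm]
    simp [ite_and]

theorem visits_le (ω : Fin K → Fin (H + 1) → S) (k : ℕ) (hk : k ≤ K) (x : S) (a : A) :
    visits R H K bonus ω k x a ≤ k * H := by
  rw [← sum_visits R H K bonus ω k hk]
  exact (Finset.single_le_sum (f := fun a => visits R H K bonus ω k x a)
    (fun _ _ => Nat.zero_le _) (Finset.mem_univ a)).trans
    (Finset.single_le_sum (f := fun x => ∑ a, visits R H K bonus ω k x a)
    (fun _ _ => Nat.zero_le _) (Finset.mem_univ x))

end Learner

section Concentration

variable (P : S → A → S → ℝ) (R : S → A → ℝ) (H K : ℕ)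
    (bonus : (S → A → ℕ) → (S → A → S → ℝ) → (ℕ → S → ℕ) → ℕ → (S → ℝ) → S → A → ℝ)
    (xinit : Fin K → S)

theorem trajProb_nonneg (hP0 : ∀ x a y, 0 ≤ P x a y) (ω : Fin K → Fin (H + 1) → S) :
    0 ≤ trajProb P R H K bonus xinit ω := by
  unfold trajProb
  refine Finset.prod_nonneg fun k _ => mul_nonneg ?_ (Finset.prod_nonneg fun p _ => hP0 _ _ _)
  split_ifs <;> norm_num

/-- Sum along the history `ω` of the increments `φ`, where `φ k ω p x y` is the increment of the
transition `x → y` at position `p` of episode `k`. -/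
noncomputable def pathSum (φ : Fin K → (Fin K → Fin (H + 1) → S) → Fin H → S → S → ℝ)
    (ω : Fin K → Fin (H + 1) → S) : ℝ :=
  ∑ k : Fin K, ∑ p : Fin H, φ k ω p (ω k p.castSucc) (ω k p.succ)

theorem sum_trajProb_mul_exp_eq_one
    (φ : Fin K → (Fin K → Fin (H + 1) → S) → Fin H → S → S → ℝ)
    (hdep : ∀ k ω ω', (∀ i < k, ω i = ω' i) → φ k ω = φ k ω')
    (hφ : ∀ k ω p x,
      ∑ y, P x (polep R H K bonus ω k.val (H - p.val) x) y * Real.exp (φ k ω p x y) = 1) :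
    ∑ ω, trajProb P R H K bonus xinit ω * Real.exp (pathSum H K φ ω) = 1 := by
  have key := sum_adapted_prod (X := Fin (H + 1) → S) K
    (fun k ω => (if ω k 0 = xinit k then (1 : ℝ) else 0) * ∏ p : Fin H,
      (P (ω k p.castSucc) (polep R H K bonus ω k.val (H - p.val) (ω k p.castSucc)) (ω k p.succ) *
        Real.exp (φ k ω p (ω k p.castSucc) (ω k p.succ)))) ?_ ?_
  · rw [← key]
    refine Finset.sum_congr rfl fun ω _ => ?_
    simp only [trajProb, pathSum, Real.exp_sum, Finset.prod_mul_distrib, mul_assoc]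
  · intro k ω ω' h
    rw [polep_congr R H K bonus k fun i hi => h i hi.le, hdep k ω ω' fun i hi => h i hi.le,
      h k le_rfl]
  · intro k ω
    have hpast : ∀ x, ∀ i < k, Function.update ω k x i = ω i :=
      fun x i hi => Function.update_of_ne hi.ne _ _
    have hpol := fun x => polep_congr R H K bonus k (hpast x)
    have hφk := fun x => hdep k _ _ (hpast x)
    simp only [hpol, hφk, Function.update_self]
    exact sum_markovPath H (fun p x y => P x (polep R H K bonus ω k.val (H - p.val) x) y *
      Real.exp (φ k ω p x y)) (hφ k ω) (xinit k)

theorem sum_trajProb (hP1 : ∀ x a, ∑ y, P x a y = 1) :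
    ∑ ω, trajProb P R H K bonus xinit ω = 1 := by
  simpa [pathSum, hP1] using sum_trajProb_mul_exp_eq_one P R H K bonus xinit
    (fun _ _ _ _ _ => 0) (fun _ _ _ _ => rfl)

/-- Exponential supermartingale bound. -/
theorem sum_trajProb_mul_exp_le_one (hP0 : ∀ x a y, 0 ≤ P x a y) (hP1 : ∀ x a, ∑ y, P x a y = 1)
    (φ : Fin K → (Fin K → Fin (H + 1) → S) → Fin H → S → S → ℝ)
    (hdep : ∀ k ω ω', (∀ i < k, ω i = ω' i) → φ k ω = φ k ω')
    (hφ : ∀ k ω p x,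
      ∑ y, P x (polep R H K bonus ω k.val (H - p.val) x) y * Real.exp (φ k ω p x y) ≤ 1) :
    ∑ ω, trajProb P R H K bonus xinit ω * Real.exp (pathSum H K φ ω) ≤ 1 := by
  let Z : Fin K → (Fin K → Fin (H + 1) → S) → Fin H → S → ℝ := fun k ω p x =>
    ∑ y, P x (polep R H K bonus ω k.val (H - p.val) x) y * Real.exp (φ k ω p x y)
  have hZ : ∀ k ω p x, 0 < Z k ω p x := by
    intro k ω p x
    have hne : ∃ y, P x (polep R H K bonus ω k.val (H - p.val) x) y ≠ 0 := by
      by_contra! h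
      have := hP1 x (polep R H K bonus ω k.val (H - p.val) x)
      simp [h] at this
    obtain ⟨y, hy⟩ := hne
    exact Finset.sum_pos' (fun y _ => mul_nonneg (hP0 _ _ _) (Real.exp_pos _).le)
      ⟨y, Finset.mem_univ y, mul_pos ((hP0 _ _ _).lt_of_ne' hy) (Real.exp_pos _)⟩
  rw [← sum_trajProb_mul_exp_eq_one P R H K bonus xinit
    (fun k ω p x y => φ k ω p x y - Real.log (Z k ω p x)) ?_ ?_]
  · refine Finset.sum_le_sum fun ω _ =>
      mul_le_mul_of_nonneg_left ?_ (trajProb_nonneg P R H K bonus xinit hP0 ω)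
    refine Real.exp_le_exp.mpr (Finset.sum_le_sum fun k _ => Finset.sum_le_sum fun p _ => ?_)
    have := Real.log_nonpos (hZ k ω p (ω k p.castSucc)).le (hφ k ω p (ω k p.castSucc))
    linarith
  · intro k ω ω' h
    simp only [Z, hdep k ω ω' h, polep_congr R H K bonus k h]
  · intro k ω p x
    simp_rw [Real.exp_sub, Real.exp_log (hZ k ω p x), ← mul_div_assoc]
    rw [← Finset.sum_div]
    exact div_self (ne_of_gt (hZ k ω p x))

/-- Simultaneous Chernoff bound for finitely many exponential supermartingales. -/
theorem one_sub_le_sum_trajProb_forall_le (hP0 : ∀ x a y, 0 ≤ P x a y)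
    (hP1 : ∀ x a, ∑ y, P x a y = 1) {ι : Type*} [Fintype ι]
    (φ : ι → Fin K → (Fin K → Fin (H + 1) → S) → Fin H → S → S → ℝ)
    (hdep : ∀ i k ω ω', (∀ i < k, ω i = ω' i) → φ i k ω = φ i k ω')
    (hφ : ∀ i k ω p x,
      ∑ y, P x (polep R H K bonus ω k.val (H - p.val) x) y * Real.exp (φ i k ω p x y) ≤ 1)
    (ℓ : ℝ) :
    1 - Fintype.card ι * Real.exp (-ℓ) ≤
      ∑ ω, if ∀ i, pathSum H K (φ i) ω ≤ ℓ then trajProb P R H K bonus xinit ω else 0 := by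
  have hpt : ∀ ω, trajProb P R H K bonus xinit ω ≤
      (if ∀ i, pathSum H K (φ i) ω ≤ ℓ then trajProb P R H K bonus xinit ω else 0) +
        ∑ i, trajProb P R H K bonus xinit ω * Real.exp (pathSum H K (φ i) ω) * Real.exp (-ℓ) := by
    intro ω
    have h0 := trajProb_nonneg P R H K bonus xinit hP0 ω
    have hterm : ∀ i, 0 ≤
        trajProb P R H K bonus xinit ω * Real.exp (pathSum H K (φ i) ω) * Real.exp (-ℓ) :=
      fun i => by positivity
    split_ifs with h
    · exact le_add_of_nonneg_right (Finset.sum_nonneg fun i _ => hterm i)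
    · push Not at h
      obtain ⟨i, hi⟩ := h
      rw [zero_add]
      refine le_trans ?_ (Finset.single_le_sum (fun i _ => hterm i) (Finset.mem_univ i))
      rw [mul_assoc, ← Real.exp_add]
      exact le_mul_of_one_le_right h0 (Real.one_le_exp (by linarith))
  have hsum := Finset.sum_le_sum fun ω (_ : ω ∈ Finset.univ) => hpt ω
  rw [sum_trajProb P R H K bonus xinit hP1, Finset.sum_add_distrib, Finset.sum_comm] at hsum
  have htail : ∑ i, ∑ ω, trajProb P R H K bonus xinit ω * Real.exp (pathSum H K (φ i) ω) *
      Real.exp (-ℓ) ≤ Fintype.card ι * Real.exp (-ℓ) := by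
    rw [← nsmul_eq_mul, ← Finset.card_univ]
    refine Finset.sum_le_card_nsmul _ _ _ fun i _ => ?_
    rw [← Finset.sum_mul]
    exact mul_le_of_le_one_left (Real.exp_pos _).le
      (sum_trajProb_mul_exp_le_one P R H K bonus xinit hP0 hP1 (φ i) (hdep i) (hφ i))
  linarith

/-- Increments observing only the transitions out of `(x, a)` in the episodes before `k`. -/
noncomputable def pairIncrement (k : ℕ) (x : S) (a : A) (g : S → ℝ) :
    Fin K → (Fin K → Fin (H + 1) → S) → Fin H → S → S → ℝ :=
  fun i ω p z y =>
    if i.val < k ∧ z = x ∧ polep R H K bonus ω i.val (H - p.val) z = a then g y else 0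

theorem pathSum_pairIncrement (k : ℕ) (hk : k ≤ K) (x : S) (a : A) (g : S → ℝ)
    (ω : Fin K → Fin (H + 1) → S) :
    pathSum H K (pairIncrement R H K bonus k x a g) ω =
      ∑ y, (transitions R H K bonus ω k x a y : ℝ) * g y := by
  rw [sum_transitions_mul R H K bonus ω k hk x a g]
  rfl

theorem pairIncrement_congr (k : ℕ) (x : S) (a : A) (g : S → ℝ) (i : Fin K)
    (ω ω' : Fin K → Fin (H + 1) → S) (h : ∀ j < i, ω j = ω' j) :
    pairIncrement R H K bonus k x a g i ω = pairIncrement R H K bonus k x a g i ω' := by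
  unfold pairIncrement
  rw [polep_congr R H K bonus i h]

theorem sum_mul_exp_pairIncrement_le (hP1 : ∀ x a, ∑ y, P x a y = 1)
    (k : ℕ) (x : S) (a : A) (g : S → ℝ) (hg : ∑ y, P x a y * Real.exp (g y) ≤ 1)
    (i : Fin K) (ω : Fin K → Fin (H + 1) → S) (p : Fin H) (z : S) :
    ∑ y, P z (polep R H K bonus ω i.val (H - p.val) z) y *
      Real.exp (pairIncrement R H K bonus k x a g i ω p z y) ≤ 1 := by
  unfold pairIncrement
  split_ifs with h
  · rw [h.2.2, h.2.1]
    exact hg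
  · simp [hP1]

end Concentration

/-- Hoeffding's exponential moment bound for a finite distribution. -/
theorem sum_mul_exp_hoeffding (q f : S → ℝ) (hq0 : ∀ y, 0 ≤ q y) (hq1 : ∑ y, q y = 1)
    (B : ℝ) (hB : 0 < B) (hf : ∀ y, |f y - ∑ z, q z * f z| ≤ B) (c : ℝ) :
    ∑ y, q y * Real.exp (c * (f y - ∑ z, q z * f z) - (c * B) ^ 2 / 2) ≤ 1 := by
  set m := ∑ z, q z * f z with hm
  have hpt : ∀ y, Real.exp (c * (f y - m)) ≤
      Real.cosh (c * B) + (f y - m) / B * Real.sinh (c * B) := by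
    intro y
    have h1 : |(f y - m) / B| ≤ 1 := by
      rw [abs_div, abs_of_pos hB, div_le_one hB]
      exact hf y
    have h2 := Real.exp_mul_le_cosh_add_mul_sinh h1 (c * B)
    have h3 : (f y - m) / B * (c * B) = c * (f y - m) := by
      field_simp
    rwa [h3] at h2
  have hmean : ∑ y, q y * (f y - m) = 0 := by
    simp_rw [mul_sub, Finset.sum_sub_distrib, ← Finset.sum_mul, hq1, one_mul]
    rw [← hm, sub_self]
  have hsum : ∑ y, q y * Real.exp (c * (f y - m)) ≤ Real.cosh (c * B) := by
    calc ∑ y, q y * Real.exp (c * (f y - m))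
        ≤ ∑ y, q y * (Real.cosh (c * B) + (f y - m) / B * Real.sinh (c * B)) :=
          Finset.sum_le_sum fun y _ => mul_le_mul_of_nonneg_left (hpt y) (hq0 y)
      _ = ∑ y, (q y * Real.cosh (c * B) + q y * (f y - m) * (Real.sinh (c * B) / B)) :=
          Finset.sum_congr rfl fun y _ => by ring
      _ = Real.cosh (c * B) := by
          rw [Finset.sum_add_distrib, ← Finset.sum_mul, ← Finset.sum_mul, hq1, hmean]
          ring
  simp_rw [Real.exp_sub, ← mul_div_assoc]
  rw [← Finset.sum_div, div_le_one (Real.exp_pos _)]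
  exact hsum.trans (Real.cosh_le_exp_half_sq _)

/-- Bernstein's exponential moment bound for the frequency of one outcome. -/
theorem sum_mul_exp_bernstein (q : S → ℝ) (hq1 : ∑ y, q y = 1)
    (y₀ : S) (hy₀ : 0 ≤ q y₀) (c : ℝ) (hc0 : 0 ≤ c) (hc1 : c ≤ 1) :
    ∑ y, q y * Real.exp (c * ((if y = y₀ then 1 else 0) - q y₀) - c ^ 2 * q y₀) ≤ 1 := by
  have hexp : Real.exp c ≤ 1 + c + c ^ 2 := by
    have := abs_le.mp (Real.abs_exp_sub_one_sub_id_le (x := c) (by rwa [abs_of_nonneg hc0]))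
    linarith [this.2]
  have hpt : ∀ y, q y * Real.exp (c * ((if y = y₀ then 1 else 0) - q y₀) - c ^ 2 * q y₀) =
      (q y + if y = y₀ then q y₀ * (Real.exp c - 1) else 0) *
        Real.exp (-(q y₀ * (c + c ^ 2))) := by
    intro y
    split_ifs with h
    · rw [h, show c * (1 - q y₀) - c ^ 2 * q y₀ = c + -(q y₀ * (c + c ^ 2)) by ring, Real.exp_add]
      ring
    · rw [add_zero]
      congr 2
      ring
  simp_rw [hpt]
  rw [← Finset.sum_mul, Finset.sum_add_distrib, hq1, Finset.sum_ite_eq' Finset.univ y₀,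
    if_pos (Finset.mem_univ _), Real.exp_neg, ← div_eq_mul_inv, div_le_one (Real.exp_pos _)]
  have h1 := Real.add_one_le_exp (q y₀ * (c + c ^ 2))
  nlinarith

section Values

theorem le_maxA (f : A → ℝ) (a : A) : f a ≤ maxA f :=
  Finset.le_sup' f (Finset.mem_univ a)

theorem maxA_le {f : A → ℝ} {c : ℝ} (h : ∀ a, f a ≤ c) : maxA f ≤ c :=
  Finset.sup'_le _ _ fun a _ => h a

theorem maxA_mono {f g : A → ℝ} (h : ∀ a, f a ≤ g a) : maxA f ≤ maxA g :=
  maxA_le fun a => (h a).trans (le_maxA g a)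

theorem apply_argmaxA (f : A → ℝ) : f (argmaxA f) = maxA f :=
  le_antisymm (le_maxA f _) (maxA_le fun a =>
    (Finset.exists_max_image Finset.univ f
      ⟨Classical.arbitrary A, Finset.mem_univ _⟩).choose_spec.2 a (Finset.mem_univ a))

/-- An average of values at most `c` is at most `c`. -/
theorem sum_mul_le_of_le {q f : S → ℝ} (hq0 : ∀ y, 0 ≤ q y) (hq1 : ∑ y, q y = 1) {c : ℝ}
    (hf : ∀ y, f y ≤ c) : ∑ y, q y * f y ≤ c :=
  calc ∑ y, q y * f y ≤ ∑ y, q y * c :=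
        Finset.sum_le_sum fun y _ => mul_le_mul_of_nonneg_left (hf y) (hq0 y)
    _ = c := by rw [← Finset.sum_mul, hq1, one_mul]

/-- Values in `[0, B]` deviate from their average by at most `B`. -/
theorem abs_sub_sum_mul_le {q f : S → ℝ} (hq0 : ∀ y, 0 ≤ q y) (hq1 : ∑ y, q y = 1) {B : ℝ}
    (hf0 : ∀ y, 0 ≤ f y) (hfB : ∀ y, f y ≤ B) (y : S) : |f y - ∑ z, q z * f z| ≤ B := by
  have h1 := sum_mul_le_of_le hq0 hq1 hfB
  have h2 : 0 ≤ ∑ z, q z * f z := Finset.sum_nonneg fun z _ => mul_nonneg (hq0 z) (hf0 z)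
  rw [abs_le]
  constructor <;> linarith [hf0 y, hfB y]

variable (P : S → A → S → ℝ) (R : S → A → ℝ)

theorem VpolJ_nonneg (hP0 : ∀ x a y, 0 ≤ P x a y) (hR0 : ∀ x a, 0 ≤ R x a)
    (π : ℕ → S → A) (j : ℕ) (x : S) : 0 ≤ VpolJ P R π j x := by
  induction j generalizing x with
  | zero => exact le_rfl
  | succ j ih =>
    exact add_nonneg (hR0 _ _) (Finset.sum_nonneg fun y _ => mul_nonneg (hP0 _ _ _) (ih y))

theorem VpolJ_le_VstarJ (hP0 : ∀ x a y, 0 ≤ P x a y) (π : ℕ → S → A) (j : ℕ) (x : S) :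
    VpolJ P R π j x ≤ VstarJ P R j x := by
  induction j generalizing x with
  | zero => exact le_rfl
  | succ j ih =>
    refine le_trans ?_ (le_maxA (fun a => R x a + ∑ y, P x a y * VstarJ P R j y) (π (j + 1) x))
    exact add_le_add_right
      (Finset.sum_le_sum fun y _ => mul_le_mul_of_nonneg_left (ih y) (hP0 _ _ _)) _

theorem VstarJ_nonneg (hP0 : ∀ x a y, 0 ≤ P x a y) (hR0 : ∀ x a, 0 ≤ R x a)
    (j : ℕ) (x : S) : 0 ≤ VstarJ P R j x :=
  (VpolJ_nonneg P R hP0 hR0 (fun _ _ => Classical.arbitrary A) j x).trans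
    (VpolJ_le_VstarJ P R hP0 _ j x)

theorem VstarJ_le (hP0 : ∀ x a y, 0 ≤ P x a y) (hP1 : ∀ x a, ∑ y, P x a y = 1)
    (hR1 : ∀ x a, R x a ≤ 1) (j : ℕ) (x : S) : VstarJ P R j x ≤ j := by
  induction j generalizing x with
  | zero => simp [VstarJ]
  | succ j ih =>
    refine maxA_le fun a => ?_
    have := sum_mul_le_of_le (hP0 x a) (hP1 x a) ih
    push_cast
    linarith [hR1 x a]

theorem Qiter_succ (Phat : S → A → S → ℝ) (Nk : S → A → ℕ)
    (Qprev : ℕ → S → A → ℝ) (H : ℕ) (b : ℕ → (S → ℝ) → S → A → ℝ) (j : ℕ) (x : S) (a : A) :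
    Qiter R Phat Nk Qprev H b (j + 1) x a =
      if Nk x a = 0 then (H : ℝ)
      else min (Qprev (j + 1) x a) (min (H : ℝ)
        (R x a + (∑ y, Phat x a y * maxA (fun b' => Qiter R Phat Nk Qprev H b j y b'))
          + b j (fun y => maxA (fun b' => Qiter R Phat Nk Qprev H b j y b')) x a)) := rfl

theorem Qiter_le (Phat : S → A → S → ℝ) (Nk : S → A → ℕ)
    (Qprev : ℕ → S → A → ℝ) (H : ℕ) (b : ℕ → (S → ℝ) → S → A → ℝ) (j : ℕ) (x : S) (a : A) :
    Qiter R Phat Nk Qprev H b j x a ≤ H := by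
  cases j with
  | zero => simp [Qiter]
  | succ j =>
    rw [Qiter_succ]
    split_ifs
    · exact le_rfl
    · exact (min_le_right _ _).trans (min_le_left _ _)

/-- One-episode optimism: if the previous Q-values are optimistic and the bonus dominates the
estimation error of the optimal values, then the new Q-values are optimistic. -/
theorem optimism_Qiter (hP0 : ∀ x a y, 0 ≤ P x a y) (hP1 : ∀ x a, ∑ y, P x a y = 1)
    (hR1 : ∀ x a, R x a ≤ 1)
    (Phat : S → A → S → ℝ) (hPhat : ∀ x a y, 0 ≤ Phat x a y) (Nk : S → A → ℕ)
    (Qprev : ℕ → S → A → ℝ) (H : ℕ) (b : ℕ → (S → ℝ) → S → A → ℝ)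
    (hprev : ∀ j < H, ∀ x a, R x a + ∑ y, P x a y * VstarJ P R j y ≤ Qprev (j + 1) x a)
    (hb : ∀ j < H, ∀ V x a, Nk x a ≠ 0 →
      ∑ y, P x a y * VstarJ P R j y ≤ ∑ y, Phat x a y * VstarJ P R j y + b j V x a)
    (j : ℕ) (hj : j < H) (x : S) (a : A) :
    R x a + ∑ y, P x a y * VstarJ P R j y ≤ Qiter R Phat Nk Qprev H b (j + 1) x a := by
  induction j generalizing x a with
  | zero =>
    have hH : (1 : ℝ) ≤ H := by exact_mod_cast hj
    have h1 := hb 0 hj (fun y => maxA (fun b' => Qiter R Phat Nk Qprev H b 0 y b')) x a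
    have h2 := hprev 0 hj x a
    rw [Qiter_succ]
    simp only [VstarJ, Qiter, mul_zero, Finset.sum_const_zero] at h1 h2 ⊢
    split_ifs with hN
    · linarith [hR1 x a]
    · have h0 : maxA (fun _ : A => (0 : ℝ)) = 0 :=
        le_antisymm (maxA_le fun _ => le_rfl)
          (le_maxA (fun _ : A => (0 : ℝ)) (Classical.arbitrary A))
      simp only [h0] at h1 ⊢
      refine le_min h2 (le_min (by linarith [hR1 x a]) ?_)
      simp only [mul_zero, Finset.sum_const_zero]
      linarith [h1 hN]
  | succ j ih =>
    have hjH : ((j + 1 : ℕ) : ℝ) + 1 ≤ H := by exact_mod_cast hj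
    have hub : R x a + ∑ y, P x a y * VstarJ P R (j + 1) y ≤ H := by
      have := sum_mul_le_of_le (hP0 x a) (hP1 x a) (VstarJ_le P R hP0 hP1 hR1 (j + 1))
      linarith [hR1 x a]
    have hV : ∀ y, VstarJ P R (j + 1) y ≤
        maxA (fun b' => Qiter R Phat Nk Qprev H b (j + 1) y b') := fun y =>
      maxA_mono fun b' => ih (Nat.lt_of_succ_lt hj) y b'
    rw [Qiter_succ]
    split_ifs with hN
    · exact hub
    · refine le_min (hprev _ hj x a) (le_min hub ?_)
      have h1 := hb (j + 1) hj
        (fun y => maxA (fun b' => Qiter R Phat Nk Qprev H b (j + 1) y b')) x a hN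
      have h2 : ∑ y, Phat x a y * VstarJ P R (j + 1) y ≤
          ∑ y, Phat x a y * maxA (fun b' => Qiter R Phat Nk Qprev H b (j + 1) y b') :=
        Finset.sum_le_sum fun y _ => mul_le_mul_of_nonneg_left (hV y) (hPhat x a y)
      linarith

end Values

section Analysis

variable (P : S → A → S → ℝ) (R : S → A → ℝ) (H K : ℕ) (L' : ℝ)

/-- Empirical transition probabilities of UCBVI-CH before episode `k`. -/
noncomputable def empirical (ω : Fin K → Fin (H + 1) → S) (k : ℕ) (x : S) (a : A) (y : S) : ℝ :=
  (transitions R H K (bonusCH H L') ω k x a y : ℝ) / visits R H K (bonusCH H L') ω k x a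

/-- Optimistic value of UCBVI-CH in episode `k` with `j` remaining steps. -/
noncomputable def optValue (ω : Fin K → Fin (H + 1) → S) (k j : ℕ) (x : S) : ℝ :=
  maxA fun a => Qep R H K (bonusCH H L') ω k j x a

/-- Difference between the optimistic value and the value of the policy played. -/
noncomputable def valueGap (ω : Fin K → Fin (H + 1) → S) (k j : ℕ) (x : S) : ℝ :=
  optValue R H K L' ω k j x - VpolJ P R (polep R H K (bonusCH H L') ω k) j x

/-- The optimal values are estimated accurately in every episode. -/
def OptimalValueConcentration (ω : Fin K → Fin (H + 1) → S) : Prop :=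
  ∀ (k : Fin K) (x : S) (a : A) (j : ℕ), j < H → 0 < visits R H K (bonusCH H L') ω k x a →
    |∑ y, empirical R H K L' ω k x a y * VstarJ P R j y - ∑ y, P x a y * VstarJ P R j y| ≤
      2 * H * √L' / √(visits R H K (bonusCH H L') ω k x a)

/-- The empirical transition probabilities do not exceed the true ones by much. -/
def TransitionConcentration (ω : Fin K → Fin (H + 1) → S) : Prop :=
  ∀ (k : Fin K) (x : S) (a : A) (y : S), 0 < visits R H K (bonusCH H L') ω k x a →
    empirical R H K L' ω k x a y - P x a y ≤
      P x a y / (50 * H) + 100 * H * L' / visits R H K (bonusCH H L') ω k x a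

/-- Bound on the contribution to the regret of a step at a pair visited `n` times before. -/
noncomputable def stepCost (S : Type*) [Fintype S] (H : ℕ) (L' : ℝ) (n : ℕ) : ℝ :=
  if n < 50 * H then (H : ℝ)
  else (7 * H * L' + 2 * H * √L') / √n + 100 * Fintype.card S * H ^ 2 * L' / n

variable {P R H K L'} {ω : Fin K → Fin (H + 1) → S}

theorem optValue_le (k : Fin K) (j : ℕ) (x : S) : optValue R H K L' ω k j x ≤ H := by
  unfold optValue
  rw [Qep_eq]
  exact maxA_le fun a => Qiter_le _ _ _ _ _ _ _ _ _

theorem optimism_epState (hP0 : ∀ x a y, 0 ≤ P x a y) (hP1 : ∀ x a, ∑ y, P x a y = 1)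
    (hR1 : ∀ x a, R x a ≤ 1) (hL : 1 ≤ L') (hω : OptimalValueConcentration P R H K L' ω)
    (k : ℕ) (hk : k ≤ K) (j : ℕ) (hj : j < H) (x : S) (a : A) :
    R x a + ∑ y, P x a y * VstarJ P R j y ≤
      (epState R H K (bonusCH H L') ω k).2.2.2 (j + 1) x a := by
  induction k generalizing j x a with
  | zero =>
    have := sum_mul_le_of_le (hP0 x a) (hP1 x a) (VstarJ_le P R hP0 hP1 hR1 j)
    have hjH : (j : ℝ) + 1 ≤ H := by exact_mod_cast hj
    simp only [epState]
    linarith [hR1 x a]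
  | succ k ih =>
    have hQ := Qep_eq R H K (bonusCH H L') ω ⟨k, hk⟩
    unfold Qep at hQ
    simp only at hQ
    rw [hQ]
    refine optimism_Qiter P R hP0 hP1 hR1 _ (fun x a y => by positivity) _ _ _ _
      (fun j hj x a => ih (Nat.le_of_succ_le hk) j hj x a) ?_ j hj x a
    intro j hj V x a hN
    have h1 := abs_le.mp (hω ⟨k, hk⟩ x a j hj (Nat.pos_of_ne_zero hN))
    simp only [empirical, bonusCH] at h1 ⊢
    have hs : √L' ≤ L' := Real.sqrt_le_iff.mpr ⟨by linarith, by nlinarith⟩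
    have h2 : 2 * H * √L' / √(visits R H K (bonusCH H L') ω k x a) ≤
        7 * H * L' * √(1 / (visits R H K (bonusCH H L') ω k x a : ℝ)) := by
      rw [Real.sqrt_div zero_le_one, Real.sqrt_one, ← mul_div_assoc, mul_one]
      gcongr
      · norm_num
    linarith [h1.1]

theorem VstarJ_le_optValue (hP0 : ∀ x a y, 0 ≤ P x a y) (hP1 : ∀ x a, ∑ y, P x a y = 1)
    (hR1 : ∀ x a, R x a ≤ 1) (hL : 1 ≤ L') (hω : OptimalValueConcentration P R H K L' ω)
    (k : Fin K) (j : ℕ) (hj : j ≤ H) (x : S) :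
    VstarJ P R j x ≤ optValue R H K L' ω k j x := by
  cases j with
  | zero =>
    unfold optValue
    rw [Qep_eq]
    exact le_maxA (fun _ : A => (0 : ℝ)) (Classical.arbitrary A)
  | succ j =>
    exact maxA_mono fun a => optimism_epState hP0 hP1 hR1 hL hω (k + 1) k.isLt j hj x a

theorem optValue_succ_le (k : Fin K) (j : ℕ) (x : S)
    (hN : 0 < visits R H K (bonusCH H L') ω k x (polep R H K (bonusCH H L') ω k (j + 1) x)) :
    optValue R H K L' ω k (j + 1) x ≤
      R x (polep R H K (bonusCH H L') ω k (j + 1) x) +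
      ∑ y, empirical R H K L' ω k x (polep R H K (bonusCH H L') ω k (j + 1) x) y *
        optValue R H K L' ω k j y +
      7 * H * L' / √(visits R H K (bonusCH H L') ω k x
        (polep R H K (bonusCH H L') ω k (j + 1) x)) := by
  have h1 : optValue R H K L' ω k (j + 1) x =
      Qep R H K (bonusCH H L') ω k (j + 1) x (polep R H K (bonusCH H L') ω k (j + 1) x) :=
    (apply_argmaxA _).symm
  rw [h1]
  generalize polep R H K (bonusCH H L') ω k (j + 1) x = a at hN
  unfold optValue
  rw [Qep_eq, Qiter_succ, if_neg hN.ne']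
  refine ((min_le_right _ _).trans (min_le_right _ _)).trans (le_of_eq ?_)
  simp only [bonusCH, empirical]
  rw [Real.sqrt_div zero_le_one, Real.sqrt_one, ← mul_div_assoc, mul_one]

/-- One-step recursion for the gap between the optimistic value and the value of the policy. -/
theorem valueGap_succ_le (hH : 1 ≤ H) (hP0 : ∀ x a y, 0 ≤ P x a y)
    (hP1 : ∀ x a, ∑ y, P x a y = 1) (hR0 : ∀ x a, 0 ≤ R x a)
    (hR1 : ∀ x a, R x a ≤ 1) (hL : 1 ≤ L') (hω : OptimalValueConcentration P R H K L' ω)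
    (hω' : TransitionConcentration P R H K L' ω) (k : Fin K) (j : ℕ) (hj : j < H) (x : S) :
    valueGap P R H K L' ω k (j + 1) x ≤
      stepCost S H L' (visits R H K (bonusCH H L') ω k x
        (polep R H K (bonusCH H L') ω k (j + 1) x)) +
      (1 + 1 / (50 * H)) *
        ∑ y, P x (polep R H K (bonusCH H L') ω k (j + 1) x) y * valueGap P R H K L' ω k j y := by
  have hup := optValue_succ_le (ω := ω) (L' := L') (R := R) k j x
  have hpol : VpolJ P R (polep R H K (bonusCH H L') ω k) (j + 1) x =
      R x (polep R H K (bonusCH H L') ω k (j + 1) x) +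
        ∑ y, P x (polep R H K (bonusCH H L') ω k (j + 1) x) y *
          VpolJ P R (polep R H K (bonusCH H L') ω k) j y := rfl
  have hstar := VstarJ_le_optValue hP0 hP1 hR1 hL hω k j hj.le
  have hpi : ∀ y, VpolJ P R (polep R H K (bonusCH H L') ω k) j y ≤ VstarJ P R j y :=
    VpolJ_le_VstarJ P R hP0 _ j
  have hgap0 : ∀ y, 0 ≤ valueGap P R H K L' ω k j y := fun y =>
    sub_nonneg.mpr ((hpi y).trans (hstar y))
  have hnn := VpolJ_nonneg P R hP0 hR0 (polep R H K (bonusCH H L') ω k) (j + 1) x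
  have hle := optValue_le (ω := ω) (L' := L') (R := R) k (j + 1) x
  generalize ha : polep R H K (bonusCH H L') ω k (j + 1) x = a at hup hpol ⊢
  have hPgap : 0 ≤ ∑ y, P x a y * valueGap P R H K L' ω k j y :=
    Finset.sum_nonneg fun y _ => mul_nonneg (hP0 _ _ _) (hgap0 y)
  have hHpos : (0 : ℝ) < H := by exact_mod_cast hH
  unfold stepCost
  split_ifs with hlow
  · have : 0 ≤ (1 + 1 / (50 * (H : ℝ))) * ∑ y, P x a y * valueGap P R H K L' ω k j y := by
      positivity
    unfold valueGap at this ⊢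
    linarith
  · push Not at hlow
    have hN : 0 < visits R H K (bonusCH H L') ω k x a := by omega
    have hup' := hup hN
    have h1 := (abs_le.mp (hω k x a j hj hN)).2
    have h2 : ∑ y, (empirical R H K L' ω k x a y - P x a y) *
          (optValue R H K L' ω k j y - VstarJ P R j y) ≤
        1 / (50 * H) * ∑ y, P x a y * valueGap P R H K L' ω k j y +
          100 * Fintype.card S * H ^ 2 * L' / visits R H K (bonusCH H L') ω k x a := by
      have hterm : ∀ y, (empirical R H K L' ω k x a y - P x a y) *
          (optValue R H K L' ω k j y - VstarJ P R j y) ≤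
          1 / (50 * H) * (P x a y * valueGap P R H K L' ω k j y) +
            100 * H ^ 2 * L' / visits R H K (bonusCH H L') ω k x a := by
        intro y
        have hB := hω' k x a y hN
        generalize visits R H K (bonusCH H L') ω k x a = n at hB hN
        have hv0 : 0 ≤ optValue R H K L' ω k j y - VstarJ P R j y := sub_nonneg.mpr (hstar y)
        have hvH : optValue R H K L' ω k j y - VstarJ P R j y ≤ H := by
          linarith [optValue_le (ω := ω) (L' := L') (R := R) k j y, VstarJ_nonneg P R hP0 hR0 j y]
        have hvgap : optValue R H K L' ω k j y - VstarJ P R j y ≤ valueGap P R H K L' ω k j y := by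
          unfold valueGap
          linarith [hpi y]
        have hP := hP0 x a y
        have hL0 : 0 ≤ L' := by linarith
        calc (empirical R H K L' ω k x a y - P x a y) *
              (optValue R H K L' ω k j y - VstarJ P R j y)
            ≤ (P x a y / (50 * H) + 100 * H * L' / n) *
              (optValue R H K L' ω k j y - VstarJ P R j y) := mul_le_mul_of_nonneg_right hB hv0
          _ = P x a y / (50 * H) * (optValue R H K L' ω k j y - VstarJ P R j y) +
              100 * H * L' / n * (optValue R H K L' ω k j y - VstarJ P R j y) := add_mul _ _ _
          _ ≤ P x a y / (50 * H) * valueGap P R H K L' ω k j y + 100 * H * L' / n * H := by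
              gcongr
          _ = 1 / (50 * H) * (P x a y * valueGap P R H K L' ω k j y) +
              100 * H ^ 2 * L' / n := by ring
      refine (Finset.sum_le_sum fun y _ => hterm y).trans (le_of_eq ?_)
      rw [Finset.sum_add_distrib, ← Finset.mul_sum, Finset.sum_const, Finset.card_univ,
        nsmul_eq_mul]
      ring
    have hexpand : ∑ y, empirical R H K L' ω k x a y * optValue R H K L' ω k j y =
        (∑ y, empirical R H K L' ω k x a y * VstarJ P R j y - ∑ y, P x a y * VstarJ P R j y) +
        ∑ y, (empirical R H K L' ω k x a y - P x a y) *
          (optValue R H K L' ω k j y - VstarJ P R j y) +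
        ∑ y, P x a y * optValue R H K L' ω k j y := by
      simp_rw [← Finset.sum_sub_distrib, ← Finset.sum_add_distrib]
      exact Finset.sum_congr rfl fun y _ => by ring
    have hgapsum : ∑ y, P x a y * valueGap P R H K L' ω k j y =
        ∑ y, P x a y * optValue R H K L' ω k j y -
          ∑ y, P x a y * VpolJ P R (polep R H K (bonusCH H L') ω k) j y := by
      simp_rw [← Finset.sum_sub_distrib, valueGap, mul_sub]
    have hdiv : (7 * H * L' + 2 * H * √L') / √(visits R H K (bonusCH H L') ω k x a : ℝ) =
        7 * H * L' / √(visits R H K (bonusCH H L') ω k x a : ℝ) +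
          2 * H * √L' / √(visits R H K (bonusCH H L') ω k x a : ℝ) := add_div _ _ _
    rw [hdiv, add_mul, one_mul]
    rw [valueGap, hpol]
    linarith

end Analysis

section Summation

/-- Unrolling a one-step recursion with growth factor `c` along a trajectory. -/
theorem le_sum_of_recursion (H : ℕ) (c : ℝ) (hc : 0 ≤ c) (d : Fin (H + 1) → ℝ) (g m : Fin H → ℝ)
    (hd : ∀ p : Fin H, d p.castSucc ≤ g p + c * (d p.succ + m p)) :
    d 0 ≤ ∑ p : Fin H, (c ^ p.val * g p + c ^ (p.val + 1) * m p) + c ^ H * d (Fin.last H) := by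
  induction H with
  | zero => simp
  | succ H ih =>
    have h0 := hd 0
    have h1 := ih (fun p => d p.succ) (fun p => g p.succ) (fun p => m p.succ) fun p => hd p.succ
    have h2 := mul_le_mul_of_nonneg_left h1 hc
    rw [Fin.sum_univ_succ]
    simp only [Fin.castSucc_zero, Fin.succ_zero_eq_one, Fin.succ_last, Fin.val_succ,
      Fin.val_zero, pow_zero, zero_add, pow_one] at h0 h2 ⊢
    rw [mul_add, Finset.mul_sum] at h2
    have h3 : ∑ p : Fin H, c * (c ^ p.val * g p.succ + c ^ (p.val + 1) * m p.succ) =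
        ∑ p : Fin H, (c ^ (p.val + 1) * g p.succ + c ^ (p.val + 1 + 1) * m p.succ) :=
      Finset.sum_congr rfl fun p _ => by ring
    rw [h3] at h2
    have h4 : c * (c ^ H * d (Fin.last (H + 1))) = c ^ (H + 1) * d (Fin.last (H + 1)) := by ring
    have h5 := h2.trans_eq (congrArg (_ + ·) h4)
    linarith

theorem stepCost_nonneg (H : ℕ) {L' : ℝ} (hL : 0 ≤ L') (n : ℕ) : 0 ≤ stepCost S H L' n := by
  unfold stepCost
  split_ifs <;> positivity

/-- Potential whose increments dominate the step costs of the visits to one state-action pair. -/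
noncomputable def costPotential (S : Type*) [Fintype S] (H : ℕ) (L' : ℝ) (n : ℕ) : ℝ :=
  H * (min n (51 * H) : ℕ) + 2.01 * (7 * H * L' + 2 * H * √L') * √n +
    1.02 * (100 * Fintype.card S * H ^ 2 * L') * Real.log n

theorem mul_stepCost_le (H : ℕ) {L' : ℝ} (hL : 0 ≤ L') {n n' : ℕ} (hn : n ≤ n')
    (hn' : n' ≤ n + H) :
    ((n' : ℝ) - n) * stepCost S H L' n ≤ costPotential S H L' n' - costPotential S H L' n := by
  have hnR : (n : ℝ) ≤ n' := by exact_mod_cast hn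
  have hsqrt : √(n : ℝ) ≤ √n' := Real.sqrt_le_sqrt hnR
  have hlog : Real.log n ≤ Real.log n' := by
    rcases Nat.eq_zero_or_pos n with h | h
    · simpa [h] using Real.log_natCast_nonneg n'
    · exact Real.log_le_log (by exact_mod_cast h) hnR
  set C₁ := 7 * H * L' + 2 * H * √L' with hC₁
  set C₂ := 100 * Fintype.card S * H ^ 2 * L' with hC₂
  have hC₁0 : 0 ≤ C₁ := by positivity
  have hC₂0 : 0 ≤ C₂ := by positivity
  have hmin : ((min n (51 * H) : ℕ) : ℝ) ≤ (min n' (51 * H) : ℕ) := by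
    exact_mod_cast min_le_min_right _ hn
  have hH0 : (0 : ℝ) ≤ H := Nat.cast_nonneg H
  have hmin' := mul_le_mul_of_nonneg_left hmin hH0
  unfold costPotential stepCost
  rw [← hC₁, ← hC₂]
  split_ifs with hlow
  · rw [min_eq_left (by omega : n ≤ 51 * H), min_eq_left (by omega : n' ≤ 51 * H)]
    have h1 := mul_le_mul_of_nonneg_left hsqrt (by positivity : 0 ≤ 2.01 * C₁)
    have h2 := mul_le_mul_of_nonneg_left hlog (by positivity : 0 ≤ 1.02 * C₂)
    linarith
  · push Not at hlow
    rcases Nat.eq_zero_or_pos n with hn0 | hnpos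
    · have : n' = 0 := by omega
      simp [hn0, this]
    have hnpos' : (0 : ℝ) < n := by exact_mod_cast hnpos
    have hn'pos : (0 : ℝ) < n' := hnpos'.trans_le hnR
    have hratio : (n' : ℝ) ≤ 1.02 * n := by
      have h1 : (n' : ℝ) ≤ n + H := by exact_mod_cast hn'
      have h2 : (50 : ℝ) * H ≤ n := by exact_mod_cast hlow
      linarith
    have hs : ((n' : ℝ) - n) / √n ≤ 2.01 * (√n' - √n) := by
      have hspos : 0 < √(n : ℝ) := Real.sqrt_pos.mpr hnpos'
      have hs' : √(n' : ℝ) ≤ 1.01 * √n := by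
        rw [Real.sqrt_le_iff]
        refine ⟨by positivity, ?_⟩
        rw [mul_pow, Real.sq_sqrt hnpos'.le]
        linarith
      rw [div_le_iff₀ hspos]
      have e1 := Real.sq_sqrt hnpos'.le
      have e2 := Real.sq_sqrt hn'pos.le
      nlinarith [mul_nonneg (sub_nonneg.mpr hsqrt) (sub_nonneg.mpr hs')]
    have hl : ((n' : ℝ) - n) / n ≤ 1.02 * (Real.log n' - Real.log n) := by
      rw [← Real.log_div hn'pos.ne' hnpos'.ne']
      have h1 := Real.one_sub_inv_le_log_of_pos (div_pos hn'pos hnpos')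
      rw [inv_div] at h1
      have h2 : ((n' : ℝ) - n) / n ≤ 1.02 * (1 - n / n') := by
        rw [one_sub_div hn'pos.ne', ← mul_div_assoc, div_le_div_iff₀ hnpos' hn'pos]
        nlinarith [mul_nonneg (sub_nonneg.mpr hnR) (sub_nonneg.mpr hratio)]
      linarith
    have h1 := mul_le_mul_of_nonneg_left hs hC₁0
    have h2 := mul_le_mul_of_nonneg_left hl hC₂0
    have h3 : ((n' : ℝ) - n) * (C₁ / √n + C₂ / n) =
        C₁ * (((n' : ℝ) - n) / √n) + C₂ * (((n' : ℝ) - n) / n) := by ring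
    rw [h3]
    linarith

/-- Total step cost of the visits to one state-action pair. -/
theorem sum_mul_stepCost_le (H K : ℕ) {L' : ℝ} (hL : 0 ≤ L') (n : ℕ → ℕ) (h0 : n 0 = 0)
    (hmono : ∀ k < K, n k ≤ n (k + 1)) (hstep : ∀ k < K, n (k + 1) ≤ n k + H) :
    ∑ k ∈ Finset.range K, ((n (k + 1) : ℝ) - n k) * stepCost S H L' (n k) ≤
      costPotential S H L' (n K) := by
  calc ∑ k ∈ Finset.range K, ((n (k + 1) : ℝ) - n k) * stepCost S H L' (n k)
      ≤ ∑ k ∈ Finset.range K, (costPotential S H L' (n (k + 1)) - costPotential S H L' (n k)) :=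
        Finset.sum_le_sum fun k hk => mul_stepCost_le H hL (hmono k (Finset.mem_range.mp hk))
          (hstep k (Finset.mem_range.mp hk))
    _ = costPotential S H L' (n K) := by
        rw [Finset.sum_range_sub (fun k => costPotential S H L' (n k)), h0]
        simp [costPotential]

variable (R : S → A → ℝ) (H K : ℕ)
    (bonus : (S → A → ℕ) → (S → A → S → ℝ) → (ℕ → S → ℕ) → ℕ → (S → ℝ) → S → A → ℝ)

/-- Regrouping a sum over the steps of a history by state-action pairs. -/
theorem sum_steps_eq_sum_pairs (ω : Fin K → Fin (H + 1) → S) (f : ℕ → ℝ) :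
    ∑ k : Fin K, ∑ p : Fin H,
        f (visits R H K bonus ω k (ω k p.castSucc) (actionAt R H K bonus ω k p)) =
      ∑ x, ∑ a, ∑ k ∈ Finset.range K,
        ((visits R H K bonus ω (k + 1) x a : ℝ) - visits R H K bonus ω k x a) *
          f (visits R H K bonus ω k x a) := by
  have hk : ∀ k : Fin K, ∑ p : Fin H,
        f (visits R H K bonus ω k (ω k p.castSucc) (actionAt R H K bonus ω k p)) =
      ∑ x, ∑ a, ((visits R H K bonus ω (k + 1) x a : ℝ) - visits R H K bonus ω k x a) *
          f (visits R H K bonus ω k x a) := by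
    intro k
    have hp : ∀ p : Fin H,
        f (visits R H K bonus ω k (ω k p.castSucc) (actionAt R H K bonus ω k p)) =
        ∑ x, ∑ a, (if ω k p.castSucc = x ∧ actionAt R H K bonus ω k p = a then (1 : ℝ) else 0) *
          f (visits R H K bonus ω k x a) := by
      intro p
      simp [ite_and]
    simp_rw [hp, visits_succ]
    push_cast
    simp_rw [add_sub_cancel_left, Finset.sum_mul]
    rw [Finset.sum_comm]
    exact Finset.sum_congr rfl fun x _ => Finset.sum_comm
  simp_rw [hk]
  rw [Finset.sum_comm]
  refine Finset.sum_congr rfl fun x _ => ?_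
  rw [Finset.sum_comm]
  refine Finset.sum_congr rfl fun a _ => ?_
  exact Fin.sum_univ_eq_sum_range (fun k =>
    ((visits R H K bonus ω (k + 1) x a : ℝ) - visits R H K bonus ω k x a) *
      f (visits R H K bonus ω k x a)) K

theorem sum_sqrt_visits_le (ω : Fin K → Fin (H + 1) → S) :
    ∑ x, ∑ a, √(visits R H K bonus ω K x a : ℝ) ≤
      √(Fintype.card S * Fintype.card A * (K * H)) := by
  apply Real.le_sqrt_of_sq_le
  have h := sq_sum_le_card_mul_sum_sq (s := (Finset.univ : Finset (S × A)))
    (f := fun z => √(visits R H K bonus ω K z.1 z.2 : ℝ))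
  simp only [Real.sq_sqrt (Nat.cast_nonneg _), Fintype.sum_prod_type, Finset.card_univ,
    Fintype.card_prod] at h
  have hs : ∑ x, ∑ a, (visits R H K bonus ω K x a : ℝ) = K * H := by
    exact_mod_cast sum_visits R H K bonus ω K le_rfl
  rw [hs] at h
  push_cast at h
  exact h

/-- Total step cost of a history. -/
theorem sum_stepCost_le (hH : 1 ≤ H) (hK : 1 ≤ K) {L' : ℝ} (hL : Real.log (K * H) ≤ L')
    (ω : Fin K → Fin (H + 1) → S) :
    ∑ k : Fin K, ∑ p : Fin H, stepCost S H L'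
        (visits R H K bonus ω k (ω k p.castSucc) (actionAt R H K bonus ω k p)) ≤
      51 * H ^ 2 * (Fintype.card S * Fintype.card A) +
      2.01 * (7 * H * L' + 2 * H * √L') * √(Fintype.card S * Fintype.card A * (K * H)) +
      102 * Fintype.card S * H ^ 2 * L' ^ 2 * (Fintype.card S * Fintype.card A) := by
  have hKH : (1 : ℝ) ≤ K * H := by exact_mod_cast Nat.mul_pos hK hH
  have hL0 : 0 ≤ L' := (Real.log_nonneg hKH).trans hL
  rw [sum_steps_eq_sum_pairs R H K bonus ω (stepCost S H L')]
  have hpair : ∀ x a, ∑ k ∈ Finset.range K,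
        ((visits R H K bonus ω (k + 1) x a : ℝ) - visits R H K bonus ω k x a) *
          stepCost S H L' (visits R H K bonus ω k x a) ≤
      51 * H ^ 2 + 2.01 * (7 * H * L' + 2 * H * √L') * √(visits R H K bonus ω K x a : ℝ) +
        102 * Fintype.card S * H ^ 2 * L' ^ 2 := by
    intro x a
    refine (sum_mul_stepCost_le (S := S) H K hL0 (fun k => visits R H K bonus ω k x a) rfl ?_
      fun k hk => visits_succ_le R H K bonus ω ⟨k, hk⟩ x a).trans ?_
    · intro k hk
      exact (visits_succ R H K bonus ω ⟨k, hk⟩ x a).symm ▸ Nat.le_add_right _ _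
    · unfold costPotential
      have h1 : ((min (visits R H K bonus ω K x a) (51 * H) : ℕ) : ℝ) ≤ 51 * H := by
        exact_mod_cast min_le_right _ _
      have h2 : Real.log (visits R H K bonus ω K x a) ≤ L' := by
        rcases Nat.eq_zero_or_pos (visits R H K bonus ω K x a) with h | h
        · simpa [h] using hL0
        · refine (Real.log_le_log (by exact_mod_cast h) ?_).trans hL
          exact_mod_cast visits_le R H K bonus ω K le_rfl x a
      have h3 := mul_le_mul_of_nonneg_left h1 (Nat.cast_nonneg (α := ℝ) H)
      have h4 := mul_le_mul_of_nonneg_left h2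
        (by positivity : 0 ≤ 1.02 * (100 * Fintype.card S * (H : ℝ) ^ 2 * L'))
      linarith
  refine (Finset.sum_le_sum fun x _ => Finset.sum_le_sum fun a _ => hpair x a).trans ?_
  simp_rw [Finset.sum_add_distrib, ← Finset.mul_sum]
  have h5 := mul_le_mul_of_nonneg_left (sum_sqrt_visits_le R H K bonus ω)
    (by positivity : 0 ≤ 2.01 * (7 * H * L' + 2 * H * √L'))
  simp only [Finset.sum_const, Finset.card_univ, nsmul_eq_mul]
  linarith

end Summation

section Regret

variable (P : S → A → S → ℝ) (R : S → A → ℝ) (H K : ℕ) (L' : ℝ)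

/-- Weighted martingale increments of the (nonnegative part of the) value gap. -/
noncomputable def gapIncrement : Fin K → (Fin K → Fin (H + 1) → S) → Fin H → S → S → ℝ :=
  fun k ω p x y => (1 + 1 / (50 * H : ℝ)) ^ (p.val + 1) *
    ((∑ z, P x (polep R H K (bonusCH H L') ω k (H - p) x) z *
      max (valueGap P R H K L' ω k (H - (p + 1)) z) 0) -
      max (valueGap P R H K L' ω k (H - (p + 1)) y) 0)

/-- The weighted sum of martingale increments of the value gap is small. -/
def GapConcentration (ω : Fin K → Fin (H + 1) → S) : Prop :=
  pathSum H K (gapIncrement P R H K L') ω ≤ 50 / 49 * H * (2 * √(L' * (K * H)))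

theorem growth_pow_le {H : ℕ} (hH : 1 ≤ H) {m : ℕ} (hm : m ≤ H) :
    (1 + 1 / (50 * H : ℝ)) ^ m ≤ 50 / 49 := by
  have hH' : (0 : ℝ) < H := by exact_mod_cast hH
  calc (1 + 1 / (50 * H : ℝ)) ^ m ≤ (1 + 1 / (50 * H : ℝ)) ^ H :=
        pow_le_pow_right₀ (le_add_of_nonneg_right (by positivity)) hm
    _ ≤ Real.exp (1 / (50 * H)) ^ H := by
        gcongr
        linarith [Real.add_one_le_exp (1 / (50 * H : ℝ))]
    _ = Real.exp (1 / 50) := by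
        rw [← Real.exp_nat_mul]
        congr 1
        field_simp
    _ ≤ 1 / (1 - 1 / 50) := Real.exp_bound_div_one_sub_of_interval (by norm_num) (by norm_num)
    _ = 50 / 49 := by norm_num

variable {P R H K L'} {ω : Fin K → Fin (H + 1) → S}

/-- Regret decomposition on the event where all estimates concentrate. -/
theorem ucbviRegret_le (hH : 1 ≤ H) (hP0 : ∀ x a y, 0 ≤ P x a y)
    (hP1 : ∀ x a, ∑ y, P x a y = 1) (hR0 : ∀ x a, 0 ≤ R x a)
    (hR1 : ∀ x a, R x a ≤ 1) (hL : 1 ≤ L') (hω : OptimalValueConcentration P R H K L' ω)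
    (hω' : TransitionConcentration P R H K L' ω) (xinit : Fin K → S)
    (hinit : ∀ k, ω k 0 = xinit k) :
    ucbviRegret P R H K (bonusCH H L') xinit ω ≤
      50 / 49 * ∑ k : Fin K, ∑ p : Fin H, stepCost S H L' (visits R H K (bonusCH H L') ω k
        (ω k p.castSucc) (actionAt R H K (bonusCH H L') ω k p)) +
      pathSum H K (gapIncrement P R H K L') ω := by
  unfold ucbviRegret pathSum
  rw [Finset.mul_sum, ← Finset.sum_add_distrib]
  refine Finset.sum_le_sum fun k _ => ?_
  have hgap0 : ∀ j ≤ H, ∀ y, 0 ≤ valueGap P R H K L' ω k j y := fun j hj y =>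
    sub_nonneg.mpr ((VpolJ_le_VstarJ P R hP0 _ j y).trans
      (VstarJ_le_optValue hP0 hP1 hR1 hL hω k j hj y))
  have hstart : VstarJ P R H (xinit k) - VpolJ P R (polep R H K (bonusCH H L') ω k) H (xinit k) ≤
      valueGap P R H K L' ω k H (ω k 0) := by
    rw [hinit k]
    exact sub_le_sub_right (VstarJ_le_optValue hP0 hP1 hR1 hL hω k H le_rfl _) _
  refine hstart.trans ?_
  have hrec := le_sum_of_recursion H (1 + 1 / (50 * H : ℝ)) (by positivity)
    (fun p => valueGap P R H K L' ω k (H - p) (ω k p))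
    (fun p => stepCost S H L' (visits R H K (bonusCH H L') ω k
        (ω k p.castSucc) (actionAt R H K (bonusCH H L') ω k p)))
    (fun p => (∑ z, P (ω k p.castSucc) (actionAt R H K (bonusCH H L') ω k p) z *
        valueGap P R H K L' ω k (H - (p + 1)) z) -
        valueGap P R H K L' ω k (H - (p + 1)) (ω k p.succ)) ?_
  · have hend : valueGap P R H K L' ω k (H - H) (ω k (Fin.last H)) = 0 := by
      rw [Nat.sub_self]
      unfold valueGap optValue
      rw [Qep_eq]
      simp only [Qiter, VpolJ, sub_zero]
      exact le_antisymm (maxA_le fun _ => le_rfl)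
        (le_maxA (fun _ : A => (0 : ℝ)) (Classical.arbitrary A))
    simp only [Fin.val_last, hend, Fin.val_zero, Nat.sub_zero, mul_zero, add_zero] at hrec
    refine hrec.trans ?_
    rw [Finset.mul_sum, ← Finset.sum_add_distrib]
    refine Finset.sum_le_sum fun p _ => ?_
    have hcost := stepCost_nonneg (S := S) H (by linarith : 0 ≤ L') (visits R H K (bonusCH H L') ω k
        (ω k p.castSucc) (actionAt R H K (bonusCH H L') ω k p))
    refine add_le_add (mul_le_mul_of_nonneg_right (growth_pow_le hH p.isLt.le) hcost) ?_
    unfold gapIncrement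
    simp_rw [max_eq_left (hgap0 (H - (p + 1)) (Nat.sub_le _ _) _)]
    rfl
  · intro p
    have h := valueGap_succ_le hH hP0 hP1 hR0 hR1 hL hω hω' k (H - (p + 1)) (by omega)
      (ω k p.castSucc)
    have hp : H - (p.val + 1) + 1 = H - p.val := by omega
    rw [hp] at h
    simp only [Fin.val_castSucc, Fin.val_succ, add_sub_cancel]
    exact h

/-- Final accounting of the regret bound in terms of `L'`. -/
theorem ucbviRegret_le_of_concentration (hH : 1 ≤ H) (hK : 1 ≤ K) (hP0 : ∀ x a y, 0 ≤ P x a y)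
    (hP1 : ∀ x a, ∑ y, P x a y = 1) (hR0 : ∀ x a, 0 ≤ R x a)
    (hR1 : ∀ x a, R x a ≤ 1) (hL : 1.5625 ≤ L') (hlog : Real.log (K * H) ≤ L')
    (hω : OptimalValueConcentration P R H K L' ω)
    (hω' : TransitionConcentration P R H K L' ω) (hgap : GapConcentration P R H K L' ω)
    (xinit : Fin K → S) (hinit : ∀ k, ω k 0 = xinit k) :
    ucbviRegret P R H K (bonusCH H L') xinit ω ≤
      20 * √((H : ℝ) ^ 3) * L' * √(Fintype.card S * Fintype.card A * K) +
        250 * H ^ 2 * (Fintype.card S : ℝ) ^ 2 * Fintype.card A * L' ^ 2 := by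
  have hreg := ucbviRegret_le hH hP0 hP1 hR0 hR1 (by linarith) hω hω' xinit hinit
  have hcost := sum_stepCost_le R H K (bonusCH H L') hH hK hlog ω
  have hgap : pathSum H K (gapIncrement P R H K L') ω ≤ _ := hgap
  have hs : (1 : ℝ) ≤ Fintype.card S := by exact_mod_cast Fintype.card_pos
  have ha : (1 : ℝ) ≤ Fintype.card A := by exact_mod_cast Fintype.card_pos
  generalize (Fintype.card S : ℝ) = s at *
  generalize (Fintype.card A : ℝ) = a at *
  have hsa : 1 ≤ s * a := one_le_mul_of_one_le_of_one_le hs ha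
  have hH0 : (0 : ℝ) ≤ H := Nat.cast_nonneg H
  have hK0 : (0 : ℝ) ≤ K := Nat.cast_nonneg K
  set X := (H : ℝ) * √(s * a * (K * H)) with hX
  have hX0 : 0 ≤ X := by positivity
  have hXeq : √((H : ℝ) ^ 3) * √(s * a * K) = X := by
    rw [hX, ← Real.sqrt_mul (by positivity),
      show (H : ℝ) ^ 3 * (s * a * K) = H ^ 2 * (s * a * (K * H)) by ring,
      Real.sqrt_mul (by positivity), Real.sqrt_sq hH0]
  have hq : √L' ≤ 0.8 * L' := by
    rw [Real.sqrt_le_iff]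
    exact ⟨by linarith, by nlinarith⟩
  have hmart : (H : ℝ) * √(L' * (K * H)) ≤ X * √L' := by
    rw [Real.sqrt_mul (by linarith), hX]
    have : √((K : ℝ) * H) ≤ √(s * a * (K * H)) :=
      Real.sqrt_le_sqrt (le_mul_of_one_le_left (by positivity) hsa)
    have := mul_le_mul_of_nonneg_left this (mul_nonneg hH0 (Real.sqrt_nonneg L'))
    linarith
  have hXq : X * √L' ≤ X * (0.8 * L') := mul_le_mul_of_nonneg_left hq hX0
  have hXL : 0 ≤ X * L' := mul_nonneg hX0 (by linarith)
  have hL2 : 2.44 ≤ L' ^ 2 := by nlinarith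
  have hlow : 51 * (H : ℝ) ^ 2 * (s * a) ≤ 51 / 2.44 * (H ^ 2 * s ^ 2 * a * L' ^ 2) := by
    have h1 : (H : ℝ) ^ 2 * (s * a) * 2.44 ≤ H ^ 2 * s ^ 2 * a * L' ^ 2 := by
      have h2 : (H : ℝ) ^ 2 * (s * a) ≤ H ^ 2 * s ^ 2 * a := by
        have : (H : ℝ) ^ 2 * (s * a) * 1 ≤ H ^ 2 * (s * a) * s :=
          mul_le_mul_of_nonneg_left hs (by positivity)
        linarith
      exact mul_le_mul h2 hL2 (by norm_num) (by positivity)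
    linarith
  have hY0 : 0 ≤ (H : ℝ) ^ 2 * s ^ 2 * a * L' ^ 2 := by positivity
  have hmain : 2.01 * (7 * H * L' + 2 * H * √L') * √(s * a * (K * H)) =
      14.07 * (X * L') + 4.02 * (X * √L') := by
    rw [hX]
    ring
  rw [hmain] at hcost
  have hfinal : 20 * √((H : ℝ) ^ 3) * L' * √(s * a * K) = 20 * (X * L') := by
    rw [← hXeq]
    ring
  rw [hfinal]
  have hlow2 : 102 * s * (H : ℝ) ^ 2 * L' ^ 2 * (s * a) =
      102 * (H ^ 2 * s ^ 2 * a * L' ^ 2) := by ring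
  have hgoal : 250 * (H : ℝ) ^ 2 * s ^ 2 * a * L' ^ 2 =
      250 * (H ^ 2 * s ^ 2 * a * L' ^ 2) := by ring
  rw [hgoal]
  linarith

end Regret

section GoodEvent

variable (P : S → A → S → ℝ) (R : S → A → ℝ) (H K : ℕ) (L' : ℝ)

/-- Tilted deviation of the optimal value after a transition out of `(x, a)`. -/
noncomputable def valueDeviation (x : S) (a : A) (j : ℕ) (c : ℝ) (y : S) : ℝ :=
  c * (VstarJ P R j y - ∑ z, P x a z * VstarJ P R j z) - (c * H) ^ 2 / 2

/-- Tilted deviation of the indicator of a transition from `(x, a)` to `y₀`. -/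
noncomputable def transitionDeviation (x : S) (a : A) (y₀ : S) (c : ℝ) (y : S) : ℝ :=
  c * ((if y = y₀ then 1 else 0) - P x a y₀) - c ^ 2 * P x a y₀

/-- Tilted increments of the value gap. -/
noncomputable def tiltedGapIncrement (c : ℝ) :
    Fin K → (Fin K → Fin (H + 1) → S) → Fin H → S → S → ℝ :=
  fun k ω p x y => c * gapIncrement P R H K L' k ω p x y - (c * (50 / 49 * H)) ^ 2 / 2

/-- Tilting parameter adapted to `n` visits. -/
noncomputable def valueTilt (n : ℕ) : ℝ := 2 * √L' / (H * √n)

/-- The supermartingale increments whose simultaneous control yields the concentration events. -/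
noncomputable def controlIncrement :
    (S × A × Fin H × Fin K × Fin (K * H) × Bool) ⊕ (S × A × S × Fin K) ⊕ Unit →
      Fin K → (Fin K → Fin (H + 1) → S) → Fin H → S → S → ℝ
  | .inl (x, a, j, k, n, s) => pairIncrement R H K (bonusCH H L') k x a
      (valueDeviation P R H x a j ((if s then 1 else -1) * valueTilt H L' (n + 1)))
  | .inr (.inl (x, a, y, k)) => pairIncrement R H K (bonusCH H L') k x a
      (transitionDeviation P x a y (1 / (50 * H)))
  | .inr (.inr _) => tiltedGapIncrement P R H K L' (2 * √L' / (50 / 49 * H * √(K * H)))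

variable {P R H K L'}

theorem gapIncrement_congr (k : Fin K) (ω ω' : Fin K → Fin (H + 1) → S)
    (h : ∀ i < k, ω i = ω' i) : gapIncrement P R H K L' k ω = gapIncrement P R H K L' k ω' := by
  unfold gapIncrement valueGap optValue
  rw [polep_congr R H K (bonusCH H L') k h, Qep_congr R H K (bonusCH H L') k h]

theorem controlIncrement_congr (i) (k : Fin K) (ω ω' : Fin K → Fin (H + 1) → S)
    (h : ∀ i < k, ω i = ω' i) :
    controlIncrement P R H K L' i k ω = controlIncrement P R H K L' i k ω' := by
  rcases i with ⟨x, a, j, k', n, s⟩ | ⟨x, a, y, k'⟩ | _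
  · exact pairIncrement_congr _ _ _ _ _ _ _ _ _ _ _ h
  · exact pairIncrement_congr _ _ _ _ _ _ _ _ _ _ _ h
  · funext p x y
    simp only [controlIncrement, tiltedGapIncrement, gapIncrement_congr k ω ω' h]

theorem sum_mul_exp_controlIncrement_le (hH : 1 ≤ H) (hP0 : ∀ x a y, 0 ≤ P x a y)
    (hP1 : ∀ x a, ∑ y, P x a y = 1) (hR0 : ∀ x a, 0 ≤ R x a) (hR1 : ∀ x a, R x a ≤ 1)
    (i) (k : Fin K) (ω : Fin K → Fin (H + 1) → S) (p : Fin H) (x : S) :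
    ∑ y, P x (polep R H K (bonusCH H L') ω k.val (H - p.val) x) y *
      Real.exp (controlIncrement P R H K L' i k ω p x y) ≤ 1 := by
  have hH0 : (0 : ℝ) < H := by exact_mod_cast hH
  rcases i with ⟨x', a, j, k', n, s⟩ | ⟨x', a, y', k'⟩ | _
  · refine sum_mul_exp_pairIncrement_le P R H K _ hP1 _ _ _ _ ?_ _ _ _ _
    refine sum_mul_exp_hoeffding (P x' a) (VstarJ P R j) (hP0 x' a) (hP1 x' a) H hH0 ?_ _
    refine abs_sub_sum_mul_le (hP0 x' a) (hP1 x' a) (VstarJ_nonneg P R hP0 hR0 j) fun y => ?_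
    exact (VstarJ_le P R hP0 hP1 hR1 j y).trans (by exact_mod_cast j.isLt.le)
  · refine sum_mul_exp_pairIncrement_le P R H K _ hP1 _ _ _ _ ?_ _ _ _ _
    refine sum_mul_exp_bernstein (P x' a) (hP1 x' a) y' (hP0 x' a y') _ (by positivity) ?_
    rw [div_le_one (by positivity)]
    have : (1 : ℝ) ≤ H := by exact_mod_cast hH
    linarith
  · simp only [controlIncrement, tiltedGapIncrement, gapIncrement]
    generalize polep R H K (bonusCH H L') ω k.val (H - p.val) x = a
    set w := (1 + 1 / (50 * H : ℝ)) ^ (p.val + 1)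
    set D : S → ℝ := fun z => max (valueGap P R H K L' ω k (H - (p + 1)) z) 0
    have hw0 : 0 ≤ w := by positivity
    have hw : w ≤ 50 / 49 := growth_pow_le hH p.isLt
    have hD0 : ∀ z, 0 ≤ D z := fun z => le_max_right _ _
    have hDH : ∀ z, D z ≤ H := fun z => max_le (by
      have h1 := optValue_le (ω := ω) (L' := L') (R := R) k (H - (p + 1)) z
      have h2 := VpolJ_nonneg P R hP0 hR0 (polep R H K (bonusCH H L') ω k) (H - (p + 1)) z
      unfold valueGap
      linarith) hH0.le
    have hmean : ∑ z, P x a z * (-(w * D z)) = -(w * ∑ z, P x a z * D z) := by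
      rw [Finset.mul_sum, ← Finset.sum_neg_distrib]
      exact Finset.sum_congr rfl fun z _ => by ring
    have hkey := sum_mul_exp_hoeffding (P x a) (fun z => -(w * D z)) (hP0 x a) (hP1 x a)
      (50 / 49 * H) (by positivity) (fun y => ?_) (2 * √L' / (50 / 49 * H * √(K * H)))
    · rw [hmean] at hkey
      refine le_of_eq_of_le (Finset.sum_congr rfl fun y _ => ?_) hkey
      congr 4
      ring
    · rw [hmean, show -(w * D y) - -(w * ∑ z, P x a z * D z) =
        -(w * (D y - ∑ z, P x a z * D z)) by ring, abs_neg, abs_mul, abs_of_nonneg hw0]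
      exact mul_le_mul hw (abs_sub_sum_mul_le (hP0 x a) (hP1 x a) hD0 hDH y) (abs_nonneg _)
        (by norm_num)

variable {ω : Fin K → Fin (H + 1) → S}

/-- Affine functions of the next state, summed over the transitions out of a visited pair. -/
theorem sum_transitions_mul_affine (k : Fin K) (x : S) (a : A)
    (hN : 0 < visits R H K (bonusCH H L') ω k x a) (f : S → ℝ) (c m d : ℝ) :
    ∑ y, (transitions R H K (bonusCH H L') ω k x a y : ℝ) * (c * (f y - m) - d) =
      visits R H K (bonusCH H L') ω k x a *
        (c * (∑ y, empirical R H K L' ω k x a y * f y - m) - d) := by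
  have hN' : (visits R H K (bonusCH H L') ω k x a : ℝ) ≠ 0 := by exact_mod_cast hN.ne'
  have h1 := sum_transitions R H K (bonusCH H L') ω k k.isLt.le x a
  have h2 : ∀ y, (transitions R H K (bonusCH H L') ω k x a y : ℝ) =
      visits R H K (bonusCH H L') ω k x a * empirical R H K L' ω k x a y := by
    intro y
    unfold empirical
    field_simp
  calc ∑ y, (transitions R H K (bonusCH H L') ω k x a y : ℝ) * (c * (f y - m) - d)
      = ∑ y, (c * (transitions R H K (bonusCH H L') ω k x a y * f y) -
          (transitions R H K (bonusCH H L') ω k x a y : ℝ) * (c * m + d)) :=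
        Finset.sum_congr rfl fun y _ => by ring
    _ = c * ∑ y, (transitions R H K (bonusCH H L') ω k x a y * f y : ℝ) -
          visits R H K (bonusCH H L') ω k x a * (c * m + d) := by
        rw [Finset.sum_sub_distrib, ← Finset.mul_sum, ← Finset.sum_mul, h1]
    _ = _ := by
        simp_rw [h2, mul_assoc]
        rw [← Finset.mul_sum]
        ring

theorem optimalValueConcentration_of_control (hH : 1 ≤ H) (hL : 0 < L')
    (hω : ∀ i, pathSum H K (controlIncrement P R H K L' i) ω ≤ 2 * L') :
    OptimalValueConcentration P R H K L' ω := by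
  intro k x a j hj hN
  have hH0 : (0 : ℝ) < H := by exact_mod_cast hH
  have hle : visits R H K (bonusCH H L') ω k x a ≤ K * H :=
    (visits_le R H K _ ω k k.isLt.le x a).trans (Nat.mul_le_mul_right H k.isLt.le)
  have hs : ∀ s : Bool, visits R H K (bonusCH H L') ω k x a *
      ((if s then 1 else -1) * valueTilt H L' (visits R H K (bonusCH H L') ω k x a) *
        (∑ y, empirical R H K L' ω k x a y * VstarJ P R j y - ∑ y, P x a y * VstarJ P R j y) -
        ((if s then 1 else -1) * valueTilt H L' (visits R H K (bonusCH H L') ω k x a) * H) ^ 2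
          / 2) ≤ 2 * L' := by
    intro s
    have h := hω (.inl (x, a, ⟨j, hj⟩, k,
      ⟨visits R H K (bonusCH H L') ω k x a - 1, by omega⟩, s))
    simp only [controlIncrement, Nat.sub_add_cancel hN] at h
    rw [pathSum_pairIncrement R H K _ k k.isLt.le] at h
    unfold valueDeviation at h
    rwa [sum_transitions_mul_affine k x a hN] at h
  generalize ∑ y, empirical R H K L' ω k x a y * VstarJ P R j y -
    ∑ y, P x a y * VstarJ P R j y = D at hs
  generalize visits R H K (bonusCH H L') ω k x a = n at hs hN
  have hn0 : (0 : ℝ) < n := by exact_mod_cast hN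
  have hsn : 0 < √(n : ℝ) := Real.sqrt_pos.mpr hn0
  have hsL : 0 < √L' := Real.sqrt_pos.mpr hL
  have hsign : ∀ e : ℝ, e ^ 2 = 1 →
      n * (e * valueTilt H L' n * D - (e * valueTilt H L' n * H) ^ 2 / 2) ≤ 2 * L' →
      e * D ≤ 2 * H * √L' / √n := by
    intro e he h
    have h1 : n * (e * valueTilt H L' n * D - (e * valueTilt H L' n * H) ^ 2 / 2) =
        2 * √L' * √n / H * (e * D) - 2 * L' := by
      unfold valueTilt
      have e1 := Real.sq_sqrt hn0.le
      have e2 := Real.sq_sqrt hL.le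
      have h2 : (e * (2 * √L' / (H * √n)) * H) ^ 2 = 4 * L' / n := by
        rw [mul_pow, mul_pow, he, div_pow, mul_pow, mul_pow, e1, e2]
        field_simp
        norm_num
      have h3 : (n : ℝ) * (2 * √L' / (H * √n)) = 2 * √L' * √n / H := by
        rw [mul_div_assoc', div_eq_div_iff (by positivity) (by positivity)]
        calc (n : ℝ) * (2 * √L') * H = √n ^ 2 * (2 * √L') * H := by rw [e1]
          _ = _ := by ring
      rw [h2, ← h3]
      field_simp
      ring
    rw [h1] at h
    rw [le_div_iff₀ hsn]
    have h4 : 2 * √L' * √n / H * (e * D) ≤ 4 * √L' ^ 2 := by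
      rw [Real.sq_sqrt hL.le]
      linarith
    rw [div_mul_eq_mul_div, div_le_iff₀ hH0] at h4
    nlinarith
  rw [abs_le]
  have hpos := hsign 1 (by norm_num) (by simpa using hs true)
  have hneg := hsign (-1) (by norm_num) (by simpa using hs false)
  constructor <;> linarith

theorem transitionConcentration_of_control (hH : 1 ≤ H)
    (hω : ∀ i, pathSum H K (controlIncrement P R H K L' i) ω ≤ 2 * L') :
    TransitionConcentration P R H K L' ω := by
  intro k x a y hN
  have hH0 : (0 : ℝ) < H := by exact_mod_cast hH
  have h := hω (.inr (.inl (x, a, y, k)))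
  simp only [controlIncrement] at h
  rw [pathSum_pairIncrement R H K _ k k.isLt.le] at h
  unfold transitionDeviation at h
  rw [sum_transitions_mul_affine k x a hN] at h
  simp only [mul_ite, mul_one, mul_zero, Finset.sum_ite_eq', Finset.mem_univ, if_true] at h
  generalize empirical R H K L' ω k x a y = e at h
  generalize visits R H K (bonusCH H L') ω k x a = n at h hN
  have hn0 : (0 : ℝ) < n := by exact_mod_cast hN
  have h1 : n * (1 / (50 * H) * (e - P x a y) - (1 / (50 * H)) ^ 2 * P x a y) =
      (n / (50 * H)) * ((e - P x a y) - P x a y / (50 * H)) := by ring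
  rw [h1, ← le_div_iff₀' (by positivity)] at h
  have h2 : 2 * L' / (n / (50 * H)) = 100 * H * L' / n := by
    field_simp
    ring
  linarith

theorem gapConcentration_of_control (hH : 1 ≤ H) (hK : 1 ≤ K) (hL : 0 < L')
    (hω : ∀ i, pathSum H K (controlIncrement P R H K L' i) ω ≤ 2 * L') :
    GapConcentration P R H K L' ω := by
  have hH0 : (0 : ℝ) < H := by exact_mod_cast hH
  have hK0 : (0 : ℝ) < K := by exact_mod_cast hK
  have h := hω (.inr (.inr ()))
  unfold GapConcentration
  have hsum : ∀ c : ℝ, pathSum H K (tiltedGapIncrement P R H K L' c) ω =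
      c * pathSum H K (gapIncrement P R H K L') ω - K * H * ((c * (50 / 49 * H)) ^ 2 / 2) := by
    intro c
    simp only [pathSum, tiltedGapIncrement, Finset.sum_sub_distrib, Finset.mul_sum,
      Finset.sum_const, Finset.card_univ, Fintype.card_fin, nsmul_eq_mul]
    ring
  simp only [controlIncrement, hsum] at h
  generalize pathSum H K (gapIncrement P R H K L') ω = G at h
  have hT : (0 : ℝ) < K * H := by positivity
  have hsT : 0 < √((K : ℝ) * H) := Real.sqrt_pos.mpr hT
  have hsL : 0 < √L' := Real.sqrt_pos.mpr hL
  have e1 := Real.sq_sqrt hT.le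
  have e2 := Real.sq_sqrt hL.le
  have h2 : (2 * √L' / (50 / 49 * H * √(K * H)) * (50 / 49 * H)) ^ 2 = 4 * L' / (K * H) := by
    rw [show 2 * √L' / (50 / 49 * H * √(K * H)) * (50 / 49 * H) = 2 * √L' / √(K * H) by
      field_simp, div_pow, mul_pow, e1, e2]
    norm_num
  rw [h2] at h
  have h3 : (K : ℝ) * H * (4 * L' / (K * H) / 2) = 2 * L' := by
    field_simp
    ring
  rw [h3] at h
  have h4 : 2 * √L' / (50 / 49 * H * √(K * H)) * G ≤ 4 * √L' ^ 2 := by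
    rw [e2]
    linarith
  rw [div_mul_eq_mul_div, div_le_iff₀ (by positivity)] at h4
  rw [Real.sqrt_mul hL.le]
  nlinarith

theorem card_mul_exp_le (s a h k δ : ℝ) (hs : 1 ≤ s) (ha : 1 ≤ a) (hh : 1 ≤ h) (hk : 1 ≤ k)
    (hδ0 : 0 < δ) (hδ1 : δ < 1) :
    (s * (a * (h * (k * (k * h * 2)))) + (s * (a * (s * k)) + 1)) *
      Real.exp (-(2 * Real.log (5 * s * a * (k * h) / δ))) ≤ δ := by
  have hpos : 0 < 5 * s * a * (k * h) / δ := by positivity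
  have hexp : Real.exp (-(2 * Real.log (5 * s * a * (k * h) / δ))) =
      δ ^ 2 / (25 * (s * a * (k * h)) ^ 2) := by
    rw [Real.exp_neg, two_mul, Real.exp_add, Real.exp_log hpos]
    field_simp
    norm_num
  rw [hexp, mul_div_assoc', div_le_iff₀ (by positivity)]
  have hsa : 1 ≤ s * a := one_le_mul_of_one_le_of_one_le hs ha
  have hkh : 1 ≤ k * h := one_le_mul_of_one_le_of_one_le hk hh
  have h1 : s * (a * (h * (k * (k * h * 2)))) ≤ 2 * (s * a * (k * h)) ^ 2 := by
    have : 1 * (s * a * (k * h) ^ 2) ≤ s * a * (s * a * (k * h) ^ 2) :=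
      mul_le_mul_of_nonneg_right hsa (by positivity)
    linarith
  have h2 : s * (a * (s * k)) ≤ (s * a * (k * h)) ^ 2 := by
    have : 1 * (s ^ 2 * a * k) ≤ a * k * h ^ 2 * (s ^ 2 * a * k) :=
      mul_le_mul_of_nonneg_right (one_le_mul_of_one_le_of_one_le
        (one_le_mul_of_one_le_of_one_le ha hk) (one_le_pow₀ hh)) (by positivity)
    linarith
  have h3 : 1 ≤ (s * a * (k * h)) ^ 2 := one_le_pow₀ (one_le_mul_of_one_le_of_one_le hsa hkh)
  have h4 : δ ^ 2 ≤ δ := by nlinarith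
  calc _ ≤ 4 * (s * a * (k * h)) ^ 2 * δ :=
        mul_le_mul (by linarith) h4 (by positivity) (by positivity)
    _ ≤ δ * (25 * (s * a * (k * h)) ^ 2) := by
        have : 0 ≤ δ * (s * a * (k * h)) ^ 2 := by positivity
        linarith

theorem le_log_five : (1.5625 : ℝ) ≤ Real.log 5 := by
  have h1 : Real.log 5 = 2 * Real.log 2 + Real.log (5 / 4) := by
    rw [← Real.log_rpow (by norm_num), ← Real.log_mul (by norm_num) (by norm_num)]
    norm_num
  have h2 := Real.one_sub_inv_le_log_of_pos (by norm_num : (0 : ℝ) < 5 / 4)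
  have h3 := Real.log_two_gt_d9
  norm_num at h2 h3 ⊢
  linarith

end GoodEvent

/-- regret bound for UCBVI-CH.  With probability at least `1 − δ` over the
interaction histories (the probability of an event being the sum of `trajProb` over the
histories in it), the regret after `K` episodes satisfies
`Regret(K) ≤ 20·H^{3/2}·L·√(S·A·K) + 250·H²·S²·A·L²` where `L = ln(5·H·S·A·T/δ)` and
`T = K·H`. -/
theorem ucbvi_ch_regret_bound
    (P : S → A → S → ℝ) (R : S → A → ℝ) (H K : ℕ) (hH : 1 ≤ H) (hK : 1 ≤ K)
    (hP0 : ∀ x a y, 0 ≤ P x a y) (hP1 : ∀ x a, ∑ y, P x a y = 1)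
    (hR0 : ∀ x a, 0 ≤ R x a) (hR1 : ∀ x a, R x a ≤ 1)
    (δ : ℝ) (hδ0 : 0 < δ) (hδ1 : δ < 1) (xinit : Fin K → S) :
    1 - δ ≤ ∑ ω : Fin K → Fin (H + 1) → S,
      (if ucbviRegret P R H K
            (bonusCH H (Real.log (5 * (Fintype.card S : ℝ) * (Fintype.card A : ℝ)
              * ((K : ℝ) * (H : ℝ)) / δ)))
            xinit ω
          ≤ 20 * Real.sqrt ((H : ℝ) ^ 3)
              * Real.log (5 * (H : ℝ) * (Fintype.card S : ℝ) * (Fintype.card A : ℝ)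
                  * ((K : ℝ) * (H : ℝ)) / δ)
              * Real.sqrt ((Fintype.card S : ℝ) * (Fintype.card A : ℝ) * (K : ℝ))
            + 250 * (H : ℝ) ^ 2 * (Fintype.card S : ℝ) ^ 2 * (Fintype.card A : ℝ)
              * (Real.log (5 * (H : ℝ) * (Fintype.card S : ℝ) * (Fintype.card A : ℝ)
                  * ((K : ℝ) * (H : ℝ)) / δ)) ^ 2
        then trajProb P R H K
            (bonusCH H (Real.log (5 * (Fintype.card S : ℝ) * (Fintype.card A : ℝ)
              * ((K : ℝ) * (H : ℝ)) / δ)))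
            xinit ω
        else 0) := by
  set L' := Real.log (5 * (Fintype.card S : ℝ) * (Fintype.card A : ℝ)
    * ((K : ℝ) * (H : ℝ)) / δ) with hL'
  set L := Real.log (5 * (H : ℝ) * (Fintype.card S : ℝ) * (Fintype.card A : ℝ)
    * ((K : ℝ) * (H : ℝ)) / δ) with hL
  have hs : (1 : ℝ) ≤ Fintype.card S := by exact_mod_cast Fintype.card_pos
  have ha : (1 : ℝ) ≤ Fintype.card A := by exact_mod_cast Fintype.card_pos
  have hh : (1 : ℝ) ≤ H := by exact_mod_cast hH
  have hk : (1 : ℝ) ≤ K := by exact_mod_cast hK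
  have hsa : 1 ≤ (Fintype.card S : ℝ) * Fintype.card A := one_le_mul_of_one_le_of_one_le hs ha
  have hkh : 1 ≤ (K : ℝ) * H := one_le_mul_of_one_le_of_one_le hk hh
  have hscale : 5 * ((K : ℝ) * H) ≤
      5 * (Fintype.card S : ℝ) * (Fintype.card A : ℝ) * ((K : ℝ) * (H : ℝ)) / δ := by
    rw [le_div_iff₀ hδ0]
    calc 5 * ((K : ℝ) * H) * δ ≤ 5 * ((K : ℝ) * H) * (Fintype.card S * Fintype.card A) :=
          mul_le_mul_of_nonneg_left (hδ1.le.trans hsa) (by positivity)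
      _ = _ := by ring
  have hL5 : 1.5625 ≤ L' :=
    le_log_five.trans (Real.log_le_log (by norm_num) (le_trans (by linarith) hscale))
  have hlog : Real.log (K * H) ≤ L' :=
    Real.log_le_log (by positivity) (le_trans (by linarith) hscale)
  have hLL : L' ≤ L := by
    refine Real.log_le_log (by positivity) ?_
    gcongr
    linarith
  have hgood := one_sub_le_sum_trajProb_forall_le P R H K (bonusCH H L') xinit hP0 hP1
    (controlIncrement P R H K L') controlIncrement_congr
    (sum_mul_exp_controlIncrement_le hH hP0 hP1 hR0 hR1) (2 * L')
  have hcard := card_mul_exp_le (Fintype.card S) (Fintype.card A) H K δ hs ha hh hk hδ0 hδ1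
  rw [← hL'] at hcard
  simp only [Fintype.card_sum, Fintype.card_prod, Fintype.card_fin, Fintype.card_bool,
    Fintype.card_unit, Nat.cast_add, Nat.cast_mul, Nat.cast_one, Nat.cast_ofNat] at hgood
  refine (sub_le_sub_left hcard 1).trans (hgood.trans (Finset.sum_le_sum fun ω _ => ?_))
  have h0 := trajProb_nonneg P R H K (bonusCH H L') xinit hP0 ω
  by_cases hω : ∀ i, pathSum H K (controlIncrement P R H K L' i) ω ≤ 2 * L'
  swap
  · rw [if_neg hω]
    split_ifs
    exacts [h0, le_rfl]
  rw [if_pos hω]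
  by_cases hinit : ∀ k, ω k 0 = xinit k
  · rw [if_pos]
    refine (ucbviRegret_le_of_concentration hH hK hP0 hP1 hR0 hR1 hL5 hlog
      (optimalValueConcentration_of_control hH (by linarith) hω)
      (transitionConcentration_of_control hH hω)
      (gapConcentration_of_control hH hK (by linarith) hω) xinit hinit).trans ?_
    have hL0 : 0 ≤ L' := by linarith
    gcongr
  · push Not at hinit
    obtain ⟨k, hk⟩ := hinit
    have hzero : trajProb P R H K (bonusCH H L') xinit ω = 0 :=
      Finset.prod_eq_zero (Finset.mem_univ k) (by rw [if_neg hk, zero_mul])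
    rw [hzero, ite_self]

end UCBVI
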